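/- arXiv:1205.2948 — 6 statements merged into one kernel-verified Lean document; each statement's English description precedes it below -/
import Mathlib

section
/- Let m be the unique nonnegative integer with m·d < max(d, q+1) ≤ (m+1)·d and set δ = E|W_1|. Then for every n ∈ ℤ and every integer k ≥ 1, E| (∏_{i=0}^{k−1} W_{n−id}) · U_{n−kd} | ≤ δ^{⌊(k−1)/(m+1)⌋}, where ⌊·⌋ denotes the integer part. -/
open MeasureTheory ProbabilityTheory Filter Finset

/-- Regrouping an independent family indexed by a product along its first index yields an
independent family of random vectors. -/
lemma iIndepFun_curry {Ω ι κ E : Type*} {mΩ : MeasurableSpace Ω} [MeasurableSpace E]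
    [Countable ι] [Countable κ] {P : Measure Ω} [IsProbabilityMeasure P] {X : ι × κ → Ω → E}
    (mX : ∀ p, Measurable (X p)) (hX : iIndepFun X P) :
    iIndepFun (fun i ω (j : κ) ↦ X (i, j) ω) P := by
  have hprob : ∀ p, IsProbabilityMeasure (P.map (X p)) := fun p ↦
    Measure.isProbabilityMeasure_map (mX p).aemeasurable
  have hrow : ∀ i, P.map (fun ω (j : κ) ↦ X (i, j) ω)
      = Measure.infinitePi fun j ↦ P.map (X (i, j)) := fun i ↦
    (iIndepFun_iff_map_fun_eq_infinitePi_map fun j ↦ mX (i, j)).mp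
      (hX.precomp (Prod.mk_right_injective i))
  rw [iIndepFun_iff_map_fun_eq_infinitePi_map (by fun_prop)]
  simp_rw [hrow]
  rw [← Measure.infinitePi_map_curry (fun i j ↦ P.map (X (i, j))),
    ← (iIndepFun_iff_map_fun_eq_infinitePi_map mX).mp hX,
    Measure.map_map (by fun_prop) (by fun_prop)]
  rfl

/-- In a product of factors in `[0, 1]`, keeping only the factors along an injective
reindexing can only increase the value. -/
lemma prod_le_prod_comp_of_le_one {ι κ : Type*} {s : Finset ι} {t : Finset κ} {f : ι → ℝ}
    {g : κ → ι} (h0 : ∀ i, 0 ≤ f i) (h1 : ∀ i, f i ≤ 1) (hg : Function.Injective g)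
    (hgt : ∀ j ∈ t, g j ∈ s) : ∏ i ∈ s, f i ≤ ∏ j ∈ t, f (g j) := by
  classical
  rw [← Finset.prod_image (f := f) hg.injOn,
    ← Finset.prod_sdiff (Finset.image_subset_iff.mpr hgt)]
  exact mul_le_of_le_one_left (Finset.prod_nonneg fun i _ ↦ h0 i)
    (Finset.prod_le_one (fun i _ ↦ h0 i) fun i _ ↦ h1 i)

/-- For functionals of length-`(q + 1)` windows of an i.i.d. sequence, windows spaced by at least
`q + 1` give independent identically distributed factors, so the expectation of the product is a
power of the common expectation. -/
lemma integral_prod_window_eq_pow {Ω : Type*} {mΩ : MeasurableSpace Ω} {P : Measure Ω}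
    [IsProbabilityMeasure P] {e : ℤ → Ω → ℝ} (he : ∀ n, Measurable (e n)) (hindep : iIndepFun e P)
    (hident : ∀ n, P.map (e n) = P.map (e 0)) {q s : ℕ} (hs : q + 1 ≤ s)
    {g : (Fin (q + 1) → ℝ) → ℝ} (hg : Measurable g) (n n₀ : ℤ) (J : ℕ) :
    ∫ ω, ∏ j : Fin J, g (fun i ↦ e (n - (j : ℕ) * (s : ℤ) - (i : ℕ)) ω) ∂P
      = (∫ ω, g (fun i ↦ e (n₀ - (i : ℕ)) ω) ∂P) ^ J := by
  have hwin : ∀ N : ℤ, Function.Injective fun i : Fin (q + 1) ↦ N - (i : ℕ) := by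
    intro N i j hij
    ext
    simp only at hij
    omega
  have hinj : Function.Injective
      fun p : Fin J × Fin (q + 1) ↦ n - (p.1 : ℕ) * (s : ℤ) - (p.2 : ℕ) := by
    rintro ⟨j, i⟩ ⟨j', i'⟩ h
    have hi := i.isLt
    have hi' := i'.isLt
    have hsum : s * (j : ℕ) + i = s * (j' : ℕ) + i' := by
      zify
      simp only at h
      linarith
    have hj : (j : ℕ) = j' := by
      have := congrArg (· / s) hsum
      simpa [Nat.mul_add_div (by omega : 0 < s), Nat.div_eq_of_lt (by omega : (i : ℕ) < s),
        Nat.div_eq_of_lt (by omega : (i' : ℕ) < s)] using this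
    rw [hj] at hsum
    exact Prod.ext (Fin.ext hj) (Fin.ext (by simpa using hsum))
  have hind := iIndepFun_curry (fun p ↦ he _) (hindep.precomp hinj)
  rw [hind.integral_fun_prod_comp (f := fun _ ↦ g) (fun j ↦ by fun_prop)
    (fun j ↦ hg.aestronglyMeasurable)]
  have hlaw : ∀ N : ℤ, ∫ ω, g (fun i ↦ e (N - (i : ℕ)) ω) ∂P
      = ∫ ω, g (fun i ↦ e (n₀ - (i : ℕ)) ω) ∂P := fun N ↦
    ((IdentDistrib.pi (fun i ↦ ⟨(he _).aemeasurable, (he _).aemeasurable,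
      (hident _).trans (hident _).symm⟩) (hindep.precomp (hwin N))
      (hindep.precomp (hwin n₀))).comp hg).integral_eq
  simp [hlaw]

/-- With `m` the unique nonnegative integer such that
`m·d < max(d, q+1) ≤ (m+1)·d` and `δ = E|W₁|`, for every `n ∈ ℤ` and `k ≥ 1`,
`E| (∏_{i=0}^{k−1} W_{n−id}) · U_{n−kd} | ≤ δ^{⌊(k−1)/(m+1)⌋}`. -/
theorem tma_product_moment_bound
    {Ω : Type*} [MeasureSpace Ω] [IsProbabilityMeasure (ℙ : Measure Ω)]
    (e : ℤ → Ω → ℝ)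
    (he : ∀ n, Measurable (e n))
    (hindep : iIndepFun e ℙ)
    (hident : ∀ n, Measure.map (e n) ℙ = Measure.map (e 0) ℙ)
    (q d : ℕ) (hq : 0 < q) (hd : 0 < d)
    (r μ1 μ2 : ℝ) (φ ψ : ℕ → ℝ)
    (a b U W : ℤ → Ω → ℝ)
    (ha : ∀ n ω, a n ω = μ2 + e n ω + ∑ i ∈ Finset.Icc 1 q, ψ i * e (n - i) ω)
    (hb : ∀ n ω, b n ω = μ1 + e n ω + ∑ i ∈ Finset.Icc 1 q, φ i * e (n - i) ω)
    (hU : ∀ n ω, U n ω = if a n ω ≤ r then 1 else 0)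
    (hW : ∀ n ω, W n ω = (if b n ω ≤ r then 1 else 0) - (if a n ω ≤ r then 1 else 0))
    (m : ℕ) (hm1 : m * d < max d (q + 1)) (hm2 : max d (q + 1) ≤ (m + 1) * d) :
    ∀ (n : ℤ) (k : ℕ), 1 ≤ k →
      ∫ ω, |(∏ i ∈ Finset.range k, W (n - (i : ℤ) * d) ω) * U (n - (k : ℤ) * d) ω| ∂ℙ
        ≤ (∫ ω, |W 1 ω| ∂ℙ) ^ ((k - 1) / (m + 1)) := by
  intro n k hk
  set s := (m + 1) * d with hs
  set J := (k - 1) / (m + 1) with hJ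
  have hqs : q + 1 ≤ s := (le_max_right _ _).trans hm2
  let lin : ℝ → (ℕ → ℝ) → (Fin (q + 1) → ℝ) → ℝ := fun c θ x ↦
    c + x 0 + ∑ i ∈ Finset.Icc 1 q, θ i * x (Fin.ofNat (q + 1) i)
  have hlin : ∀ c θ, Measurable (lin c θ) := fun c θ ↦ by fun_prop
  have hwin : ∀ c θ N ω, lin c θ (fun i ↦ e (N - (i : ℕ)) ω)
      = c + e N ω + ∑ i ∈ Finset.Icc 1 q, θ i * e (N - i) ω := by
    intro c θ N ω
    simp only [lin, Fin.val_zero, Nat.cast_zero, sub_zero, Fin.ofNat]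
    congr 1
    refine Finset.sum_congr rfl fun i hi ↦ ?_
    rw [Nat.mod_eq_of_lt (by have := (Finset.mem_Icc.mp hi).2; omega)]
  let g : (Fin (q + 1) → ℝ) → ℝ := fun x ↦
    |(if lin μ1 φ x ≤ r then 1 else 0) - (if lin μ2 ψ x ≤ r then 1 else 0)|
  have hg : Measurable g := continuous_abs.measurable.comp
    ((Measurable.ite (measurableSet_le (hlin _ _) measurable_const) measurable_const
      measurable_const).sub (Measurable.ite (measurableSet_le (hlin _ _) measurable_const)
      measurable_const measurable_const))
  have hWg : ∀ N ω, |W N ω| = g (fun i ↦ e (N - (i : ℕ)) ω) := fun N ω ↦ by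
    simp only [g, hwin, hW, ha, hb]
  have hg1 : ∀ x, g x ≤ 1 := fun x ↦ by
    simp only [g]
    split_ifs <;> norm_num
  have hg0 : ∀ x, 0 ≤ g x := fun x ↦ abs_nonneg _
  clear_value g
  have hU1 : ∀ N ω, |U N ω| ≤ 1 := fun N ω ↦ by
    rw [hU]
    split_ifs <;> norm_num
  have hpoint : ∀ ω, |(∏ i ∈ Finset.range k, W (n - (i : ℤ) * d) ω) * U (n - (k : ℤ) * d) ω|
      ≤ ∏ j : Fin J, g (fun i ↦ e (n - (j : ℕ) * (s : ℤ) - (i : ℕ)) ω) := by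
    intro ω
    rw [abs_mul, Finset.abs_prod]
    refine (mul_le_of_le_one_right (Finset.prod_nonneg fun _ _ ↦ abs_nonneg _)
      (hU1 _ _)).trans ?_
    refine (prod_le_prod_comp_of_le_one (t := Finset.univ)
      (g := fun j : Fin J ↦ (j : ℕ) * (m + 1)) (fun _ ↦ abs_nonneg _)
      (fun i ↦ (hWg _ ω).trans_le (hg1 _)) ?_ ?_).trans_eq ?_
    · intro i j hij
      exact Fin.ext (Nat.eq_of_mul_eq_mul_right m.succ_pos hij)
    · intro j _
      have h1 : (j : ℕ) * (m + 1) ≤ J * (m + 1) := Nat.mul_le_mul_right _ j.isLt.le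
      have h2 : J * (m + 1) ≤ k - 1 := Nat.div_mul_le_self _ _
      exact Finset.mem_range.mpr (by omega)
    · refine Finset.prod_congr rfl fun j _ ↦ ?_
      rw [hWg, hs]
      push_cast
      simp only [mul_assoc]
  have hint : Integrable
      (fun ω ↦ ∏ j : Fin J, g (fun i ↦ e (n - (j : ℕ) * (s : ℤ) - (i : ℕ)) ω)) ℙ := by
    refine Integrable.of_bound (C := 1) (Measurable.aestronglyMeasurable (by fun_prop))
      (ae_of_all _ fun ω ↦ ?_)
    rw [Real.norm_of_nonneg (Finset.prod_nonneg fun _ _ ↦ hg0 _)]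
    exact Finset.prod_le_one (fun _ _ ↦ hg0 _) fun _ _ ↦ hg1 _
  refine (integral_mono_of_nonneg (ae_of_all _ fun ω ↦ abs_nonneg _) hint
    (ae_of_all _ hpoint)).trans_eq ?_
  rw [integral_prod_window_eq_pow he hindep hident hqs hg n 1 J]
  simp_rw [hWg]
end

section
/- Assume the non-degeneracy condition P(a_1 ≤ r, b_1 ≤ r) + P(a_1 > r, b_1 > r) ≠ 0, and define S_n = μ2 + e_n + Σ_{i=1}^q ψ_i e_{n−i} + [(μ1 − μ2) + Σ_{i=1}^q (φ_i − ψ_i) e_{n−i}]·α_{n−d}, i.e. S_n = a_n + (b_n − a_n)·α_{n−d}. Then for every n ∈ ℤ, 1(S_n ≤ r) = α_n almost surely. -/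
open MeasureTheory ProbabilityTheory Filter Finset

/-- If a family indexed by pairs is independent, then so is the family of its rows. -/
lemma ProbabilityTheory.iIndepFun.curry {Ω ι κ : Type*} {𝓧 : Type*}
    [MeasurableSpace Ω] [MeasurableSpace 𝓧] {P : Measure Ω} {X : ι → κ → Ω → 𝓧}
    (mX : ∀ i j, Measurable (X i j)) (h : iIndepFun (fun (p : ι × κ) ω ↦ X p.1 p.2 ω) P) :
    iIndepFun (fun i ω j ↦ X i j ω) P := by
  have := h.isProbabilityMeasure
  have (i : ι) (j : κ) : IsProbabilityMeasure (P.map (X i j)) :=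
    Measure.isProbabilityMeasure_map (mX i j).aemeasurable
  have hrow (i : ι) : iIndepFun (X i) P :=
    h.precomp (g := fun j ↦ (i, j)) (Prod.mk_right_injective i)
  have hcurry : (MeasurableEquiv.curry ι κ 𝓧) ∘ (fun ω (p : ι × κ) ↦ X p.1 p.2 ω) =
      fun ω i j ↦ X i j ω := rfl
  rw [iIndepFun_iff_map_fun_eq_infinitePi_map (by fun_prop), ← hcurry,
    ← Measure.map_map (by fun_prop) (by fun_prop),
    (iIndepFun_iff_map_fun_eq_infinitePi_map (by fun_prop)).1 h,
    Measure.infinitePi_map_curry (fun i j ↦ P.map (X i j))]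
  congrm Measure.infinitePi fun i ↦ ?_
  rw [(iIndepFun_iff_map_fun_eq_infinitePi_map (by fun_prop)).1 (hrow i)]

/-- The vector of the `q + 1` most recent values of the process `e` at time `n`. -/
def backwardWindow {Ω : Type*} (e : ℤ → Ω → ℝ) (q : ℕ) (n : ℤ) (ω : Ω) (j : Fin (q + 1)) : ℝ :=
  e (n - (j : ℕ)) ω

section Window

variable {Ω : Type*} [MeasurableSpace Ω] {P : Measure Ω} {e : ℤ → Ω → ℝ}

lemma measurable_backwardWindow (he : ∀ n, Measurable (e n)) (q : ℕ) (n : ℤ) :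
    Measurable (backwardWindow e q n) :=
  measurable_pi_lambda _ fun _ ↦ he _

/-- All windows of an i.i.d. process have the same law. -/
lemma map_backwardWindow (he : ∀ n, Measurable (e n)) (hindep : iIndepFun e P)
    (hident : ∀ n, Measure.map (e n) P = Measure.map (e 0) P) (q : ℕ) (n : ℤ) :
    P.map (backwardWindow e q n) = Measure.pi fun _ ↦ P.map (e 0) := by
  have hinj : Function.Injective fun j : Fin (q + 1) ↦ n - (j : ℕ) := by
    intro i j hij
    ext
    simpa using hij
  have h := (hindep.precomp hinj).map_fun_eq_pi_map fun j ↦ (he _).aemeasurable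
  simp only [hident] at h
  exact h

/-- Windows spaced by more than their length are independent. -/
lemma iIndepFun_backwardWindow (he : ∀ n, Measurable (e n)) (hindep : iIndepFun e P)
    {q L : ℕ} (hL : q + 1 ≤ L) (n : ℤ) :
    iIndepFun (fun k : ℕ ↦ backwardWindow e q (n - (k : ℤ) * L)) P := by
  refine iIndepFun.curry (X := fun (k : ℕ) (j : Fin (q + 1)) ↦ e (n - (k : ℤ) * L - (j : ℕ)))
    (fun _ _ ↦ he _) ?_
  refine hindep.precomp (g := fun p : ℕ × Fin (q + 1) ↦ n - (p.1 : ℤ) * L - ((p.2 : ℕ) : ℤ)) ?_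
  rintro ⟨k, i⟩ ⟨l, j⟩ h
  have h' : L * k + i = L * l + j := by
    zify
    linarith [h]
  have hi : (i : ℕ) < L := i.isLt.trans_le hL
  have hj : (j : ℕ) < L := j.isLt.trans_le hL
  have hkl : k = l := by
    have := congrArg (· / L) h'
    simpa [Nat.mul_add_div (by omega : 0 < L), Nat.div_eq_of_lt hi, Nat.div_eq_of_lt hj] using this
  subst hkl
  have hij : i = j := Fin.ext (by omega)
  rw [hij]

/-- A set of positive probability is almost surely visited by the windows of an i.i.d. process
along any sufficiently sparse arithmetic progression of times. -/
lemma ae_exists_backwardWindow_mem (he : ∀ n, Measurable (e n)) (hindep : iIndepFun e P)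
    (hident : ∀ n, Measure.map (e n) P = Measure.map (e 0) P) {q L : ℕ} (hL : q + 1 ≤ L)
    {G : Set (Fin (q + 1) → ℝ)} (hG : MeasurableSet G) {m : ℤ}
    (hpos : P (backwardWindow e q m ⁻¹' G) ≠ 0) (n : ℤ) :
    ∀ᵐ ω ∂P, ∃ k : ℕ, backwardWindow e q (n - (k : ℤ) * L) ω ∈ G := by
  have := hindep.isProbabilityMeasure
  have hmeas (i : ℤ) : MeasurableSet (backwardWindow e q i ⁻¹' G) :=
    measurable_backwardWindow he q i hG
  have hprob (i : ℤ) : P (backwardWindow e q i ⁻¹' G) = P (backwardWindow e q m ⁻¹' G) := by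
    rw [← Measure.map_apply (measurable_backwardWindow he q i) hG,
      ← Measure.map_apply (measurable_backwardWindow he q m) hG,
      map_backwardWindow he hindep hident, map_backwardWindow he hindep hident]
  have hind : iIndepSet (fun k : ℕ ↦ backwardWindow e q (n - (k : ℤ) * L) ⁻¹' G) P :=
    (iIndepSet_iff_meas_biInter fun k ↦ hmeas _).2 fun s ↦
      (iIndepFun_backwardWindow he hindep hL n).measure_inter_preimage_eq_mul s
        (sets := fun _ ↦ G) fun _ _ ↦ hG
  have hone := measure_limsup_eq_one (fun k ↦ hmeas _) hind (by
    simp_rw [hprob]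
    exact ENNReal.tsum_const_eq_top_of_ne_zero hpos)
  have hlim := (prob_compl_eq_zero_iff
    (MeasurableSet.measurableSet_limsup fun k ↦ hmeas (n - (k : ℤ) * L))).2 hone
  filter_upwards [mem_ae_iff.2 hlim] with ω hω
  exact (mem_limsup_iff_frequently_mem.1 hω).exists

end Window

section Series

variable {w u : ℕ → ℝ}

/-- One step of the backward recursion solved by `∑ j, (∏ s < j, w (m + s)) * u (m + j)`, valid as
soon as `w` vanishes at some later index. -/
lemma tsum_prod_mul_eq_add {m k : ℕ} (hk : w (m + 1 + k) = 0) :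
    ∑' j, (∏ s ∈ range j, w (m + s)) * u (m + j) =
      u m + w m * ∑' j, (∏ s ∈ range j, w (m + 1 + s)) * u (m + 1 + j) := by
  have hsum : Summable fun j ↦ (∏ s ∈ range j, w (m + s)) * u (m + j) := by
    refine summable_of_ne_finset_zero (s := range (k + 2)) fun j hj ↦ ?_
    rw [prod_eq_zero (i := k + 1) _ (by rw [← hk]; congr 1; ring), zero_mul]
    simp only [mem_range] at hj ⊢
    omega
  rw [hsum.tsum_eq_zero_add, ← tsum_mul_left]
  simp only [range_zero, prod_empty, one_mul, add_zero]
  congr 1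
  refine tsum_congr fun j ↦ ?_
  rw [prod_range_succ', add_zero]
  simp only [add_assoc, add_comm 1]
  ring

/-- If `u` and `u + w` take values in `{0, 1}` and `w` vanishes at some index, then the series
solving the backward recursion takes values in `{0, 1}`. -/
lemma tsum_prod_mul_eq_zero_or_one (hu : ∀ m, u m = 0 ∨ u m = 1)
    (huw : ∀ m, u m + w m = 0 ∨ u m + w m = 1) {m k : ℕ} (hk : w (m + k) = 0) :
    ∑' j, (∏ s ∈ range j, w (m + s)) * u (m + j) = 0 ∨
      ∑' j, (∏ s ∈ range j, w (m + s)) * u (m + j) = 1 := by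
  induction k generalizing m with
  | zero =>
    rw [tsum_eq_single 0]
    · simpa using hu m
    · intro j hj
      rw [prod_eq_zero (mem_range.2 (Nat.pos_of_ne_zero hj)) hk, zero_mul]
  | succ k ih =>
    have hk' : w (m + 1 + k) = 0 := by rw [← hk]; congr 1; ring
    rw [tsum_prod_mul_eq_add hk']
    rcases ih hk' with h | h <;> rw [h]
    · simpa using hu m
    · simpa using huw m

end Series

/-- Under the non-degeneracy condition, with
`S_n = a_n + (b_n − a_n)·α_{n−d}`, for every `n ∈ ℤ` one has
`1(S_n ≤ r) = α_n` almost surely. -/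
theorem tma_indicator_of_solution
    {Ω : Type*} [MeasureSpace Ω] [IsProbabilityMeasure (ℙ : Measure Ω)]
    (e : ℤ → Ω → ℝ)
    (he : ∀ n, Measurable (e n))
    (hindep : iIndepFun e ℙ)
    (hident : ∀ n, Measure.map (e n) ℙ = Measure.map (e 0) ℙ)
    (q d : ℕ) (hq : 0 < q) (hd : 0 < d)
    (r μ1 μ2 : ℝ) (φ ψ : ℕ → ℝ)
    (a b U W : ℤ → Ω → ℝ)
    (ha : ∀ n ω, a n ω = μ2 + e n ω + ∑ i ∈ Finset.Icc 1 q, ψ i * e (n - i) ω)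
    (hb : ∀ n ω, b n ω = μ1 + e n ω + ∑ i ∈ Finset.Icc 1 q, φ i * e (n - i) ω)
    (hU : ∀ n ω, U n ω = if a n ω ≤ r then 1 else 0)
    (hW : ∀ n ω, W n ω = (if b n ω ≤ r then 1 else 0) - (if a n ω ≤ r then 1 else 0))
    (hnd : ℙ {ω | a 1 ω ≤ r ∧ b 1 ω ≤ r} + ℙ {ω | r < a 1 ω ∧ r < b 1 ω} ≠ 0)
    (α : ℤ → Ω → ℝ)
    (hα : ∀ n ω, α n ω =
      ∑' j : ℕ, (∏ s ∈ Finset.range j, W (n - (s : ℤ) * d) ω) * U (n - (j : ℤ) * d) ω)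
    (S : ℤ → Ω → ℝ)
    (hS : ∀ n ω, S n ω = a n ω + (b n ω - a n ω) * α (n - d) ω) :
    ∀ n : ℤ, ∀ᵐ ω ∂ℙ, (if S n ω ≤ r then (1 : ℝ) else 0) = α n ω := by
  intro n
  have hdi : (0 : ℤ) < d := by exact_mod_cast hd
  let F (μ : ℝ) (c : ℕ → ℝ) (z : Fin (q + 1) → ℝ) : ℝ :=
    μ + z 0 + ∑ i : Fin q, c (i + 1) * z i.succ
  have hF (μ : ℝ) (c : ℕ → ℝ) : Measurable (F μ c) := by fun_prop
  have hFe (μ : ℝ) (c : ℕ → ℝ) (m : ℤ) (ω : Ω) : F μ c (backwardWindow e q m ω) =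
      μ + e m ω + ∑ i ∈ Finset.Icc 1 q, c i * e (m - i) ω := by
    have hIcc : Finset.Icc 1 q = Finset.Ico (0 + 1) (q + 1) := by ext; simp
    rw [hIcc, ← Finset.sum_Ico_add' (fun i : ℕ ↦ c i * e (m - i) ω), ← Finset.range_eq_Ico,
      Finset.sum_range]
    simp [F, backwardWindow]
  let G : Set (Fin (q + 1) → ℝ) :=
    {z | F μ2 ψ z ≤ r ∧ F μ1 φ z ≤ r} ∪ {z | r < F μ2 ψ z ∧ r < F μ1 φ z}
  have hG : MeasurableSet G :=
    ((measurableSet_le (hF _ _) measurable_const).inter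
      (measurableSet_le (hF _ _) measurable_const)).union
    ((measurableSet_lt measurable_const (hF _ _)).inter
      (measurableSet_lt measurable_const (hF _ _)))
  have hGW (m : ℤ) (ω : Ω) (h : backwardWindow e q m ω ∈ G) : W m ω = 0 := by
    simp only [G, Set.mem_union, Set.mem_ofPred_eq, hFe, ← ha, ← hb] at h
    rw [hW]
    rcases h with ⟨h1, h2⟩ | ⟨h1, h2⟩
    · simp [h1, h2]
    · simp [h1.not_ge, h2.not_ge]
  have hpos : ℙ (backwardWindow e q 1 ⁻¹' G) ≠ 0 := by
    contrapose! hnd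
    have hpre : backwardWindow e q 1 ⁻¹' G =
        {ω | a 1 ω ≤ r ∧ b 1 ω ≤ r} ∪ {ω | r < a 1 ω ∧ r < b 1 ω} := by
      ext ω
      simp only [G, Set.mem_preimage, Set.mem_union, Set.mem_ofPred_eq, hFe, ← ha, ← hb]
    rw [hpre, measure_union_null_iff] at hnd
    rw [hnd.1, hnd.2, add_zero]
  filter_upwards [ae_exists_backwardWindow_mem he hindep hident
    (Nat.le_mul_of_pos_right (q + 1) hd) hG hpos (n - d)] with ω ⟨k, hk⟩
  let w (s : ℕ) : ℝ := W (n - (s : ℤ) * d) ω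
  let u (s : ℕ) : ℝ := U (n - (s : ℤ) * d) ω
  have hwk : w (0 + 1 + k * (q + 1)) = 0 := by
    rw [← hGW _ _ hk]
    simp only [w]
    congr 1
    push_cast
    ring
  have hu (m : ℕ) : u m = 0 ∨ u m = 1 := by
    simp only [u, hU]
    split_ifs <;> simp
  have huw (m : ℕ) : u m + w m = 0 ∨ u m + w m = 1 := by
    simp only [u, w, hU, hW]
    split_ifs <;> simp
  have hα0 : α n ω = ∑' j, (∏ s ∈ range j, w (0 + s)) * u (0 + j) := by
    simp only [hα, w, u, zero_add]
  have hα1 : α (n - d) ω = ∑' j, (∏ s ∈ range j, w (0 + 1 + s)) * u (0 + 1 + j) := by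
    have hidx (s : ℕ) : n - d - (s : ℤ) * d = n - ((0 + 1 + s : ℕ) : ℤ) * d := by
      push_cast
      ring
    simp only [hα, w, u, hidx]
  have hrec := tsum_prod_mul_eq_add (u := u) hwk
  have hbin := tsum_prod_mul_eq_zero_or_one hu huw hwk
  rw [← hα0, ← hα1] at hrec
  rw [← hα1] at hbin
  have hw0 : w 0 = W n ω := by simp [w]
  have hu0 : u 0 = U n ω := by simp [u]
  rw [hrec, hS, hw0, hu0, hU, hW]
  rcases hbin with h | h <;> rw [h] <;> simp
end

section
/- Assume the non-degeneracy condition P(a_1 ≤ r, b_1 ≤ r) + P(a_1 > r, b_1 > r) ≠ 0. Then the process S_n = a_n + (b_n − a_n)·α_{n−d} is strictly stationary: for every n, h ∈ ℤ and every integer k ≥ 1, the random vector (S_{n+1+h}, …, S_{n+k+h}) has the same distribution as (S_{n+1}, …, S_{n+k}). -/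
open MeasureTheory ProbabilityTheory Filter Finset

/-- `X` is a factor of the process `e`: each `X n` is one fixed measurable function of the
trajectory of `e` seen from time `n`. -/
def IsFactorProcess {Ω : Type*} (e X : ℤ → Ω → ℝ) : Prop :=
  ∃ f : (ℤ → ℝ) → ℝ, Measurable f ∧ ∀ n ω, X n ω = f fun m => e (n + m) ω

namespace IsFactorProcess

variable {Ω : Type*} {e X Y : ℤ → Ω → ℝ}

lemma self (e : ℤ → Ω → ℝ) : IsFactorProcess e e :=
  ⟨fun x => x 0, measurable_pi_apply 0, by simp⟩

lemma sub_const (hX : IsFactorProcess e X) (c : ℤ) :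
    IsFactorProcess e fun n => X (n - c) := by
  obtain ⟨f, hf, hfX⟩ := hX
  refine ⟨fun x => f fun m => x (m - c),
    hf.comp (measurable_pi_lambda _ fun m => measurable_pi_apply _), fun n ω => ?_⟩
  simp only [hfX]
  congr 1
  ext m
  congr 1
  ring

lemma comp {ι : Type*} {X : ι → ℤ → Ω → ℝ} (hX : ∀ i, IsFactorProcess e (X i))
    {F : (ι → ℝ) → ℝ} (hF : Measurable F) :
    IsFactorProcess e fun n ω => F fun i => X i n ω := by
  choose f hf hfX using hX
  exact ⟨fun x => F fun i => f i x, hF.comp (measurable_pi_lambda _ hf),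
    fun n ω => by simp only [hfX]⟩

lemma comp₂ (hX : IsFactorProcess e X) (hY : IsFactorProcess e Y)
    {F : ℝ × ℝ → ℝ} (hF : Measurable F) :
    IsFactorProcess e fun n ω => F (X n ω, Y n ω) := by
  obtain ⟨f, hf, hfX⟩ := hX
  obtain ⟨g, hg, hgY⟩ := hY
  exact ⟨fun x => F (f x, g x), hF.comp (hf.prodMk hg), fun n ω => by simp only [hfX, hgY]⟩

lemma movingAverage (e : ℤ → Ω → ℝ) (q : ℕ) (μ : ℝ) (c : ℕ → ℝ) :
    IsFactorProcess e fun n ω => μ + e n ω + ∑ i ∈ Finset.Icc 1 q, c i * e (n - i) ω := by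
  have := comp (fun i : ℕ => (self e).sub_const i)
    (F := fun x => μ + x 0 + ∑ i ∈ Finset.Icc 1 q, c i * x i) (by fun_prop)
  simpa using this

/-- The series solution of `α n = U n + W n * α (n - d)` is a factor. -/
lemma tsum_prod_mul {U W : ℤ → Ω → ℝ} (hU : IsFactorProcess e U) (hW : IsFactorProcess e W)
    (d : ℤ) : IsFactorProcess e fun n ω =>
      ∑' j : ℕ, (∏ s ∈ range j, W (n - (s : ℤ) * d) ω) * U (n - (j : ℤ) * d) ω := by
  have hF : Measurable fun x : ℕ ⊕ ℕ → ℝ =>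
      ∑' j : ℕ, (∏ s ∈ range j, x (Sum.inl s)) * x (Sum.inr j) :=
    by fun_prop
  have hX : ∀ i, IsFactorProcess e (Sum.elim (fun (s : ℕ) n => W (n - (s : ℤ) * d))
      (fun (j : ℕ) n => U (n - (j : ℤ) * d)) i) := by
    rintro (s | j)
    · exact hW.sub_const _
    · exact hU.sub_const _
  exact comp hX hF

end IsFactorProcess

/-- The law of an i.i.d. trajectory is invariant under time shifts. -/
lemma map_shift_eq_of_iIndepFun {Ω E : Type*} [MeasurableSpace Ω] [MeasurableSpace E]
    {P : Measure Ω} {e : ℤ → Ω → E} (he : ∀ n, Measurable (e n)) (hindep : iIndepFun e P)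
    (hident : ∀ n, P.map (e n) = P.map (e 0)) (h : ℤ) :
    P.map (fun ω m => e (m + h) ω) = P.map fun ω m => e m ω := by
  rw [(hindep.precomp (add_left_injective h)).map_fun_eq_infinitePi_map fun m => he _,
    hindep.map_fun_eq_infinitePi_map he]
  simp only [hident]

/-- A factor of an i.i.d. process is strictly stationary. -/
lemma IsFactorProcess.map_shift_eq {Ω ι : Type*} [MeasurableSpace Ω] {P : Measure Ω}
    {e X : ℤ → Ω → ℝ} (hX : IsFactorProcess e X) (he : ∀ n, Measurable (e n))
    (hindep : iIndepFun e P) (hident : ∀ n, P.map (e n) = P.map (e 0)) (t : ι → ℤ) (h : ℤ) :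
    P.map (fun ω i => X (t i + h) ω) = P.map fun ω i => X (t i) ω := by
  obtain ⟨f, hf, hfX⟩ := hX
  have hG : Measurable fun (x : ℤ → ℝ) (i : ι) => f fun m => x (t i + m) :=
    measurable_pi_lambda _ fun i =>
      hf.comp (measurable_pi_lambda _ fun m => measurable_pi_apply _)
  have key := congrArg (Measure.map fun (x : ℤ → ℝ) (i : ι) => f fun m => x (t i + m))
    (map_shift_eq_of_iIndepFun he hindep hident h)
  rw [Measure.map_map hG (measurable_pi_lambda _ fun m => he _),
    Measure.map_map hG (measurable_pi_lambda _ he)] at key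
  simp only [hfX]
  simpa only [Function.comp_def, add_right_comm] using key

/-- Under the non-degeneracy condition, the process
`S_n = a_n + (b_n − a_n)·α_{n−d}` is strictly stationary: for every `n, h ∈ ℤ`
and every integer `k ≥ 1`, the random vector `(S_{n+1+h}, …, S_{n+k+h})` has the
same distribution as `(S_{n+1}, …, S_{n+k})`. -/
theorem tma_S_strictly_stationary
    {Ω : Type*} [MeasureSpace Ω] [IsProbabilityMeasure (ℙ : Measure Ω)]
    (e : ℤ → Ω → ℝ)
    (he : ∀ n, Measurable (e n))
    (hindep : iIndepFun e ℙ)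
    (hident : ∀ n, Measure.map (e n) ℙ = Measure.map (e 0) ℙ)
    (q d : ℕ) (hq : 0 < q) (hd : 0 < d)
    (r μ1 μ2 : ℝ) (φ ψ : ℕ → ℝ)
    (a b U W : ℤ → Ω → ℝ)
    (ha : ∀ n ω, a n ω = μ2 + e n ω + ∑ i ∈ Finset.Icc 1 q, ψ i * e (n - i) ω)
    (hb : ∀ n ω, b n ω = μ1 + e n ω + ∑ i ∈ Finset.Icc 1 q, φ i * e (n - i) ω)
    (hU : ∀ n ω, U n ω = if a n ω ≤ r then 1 else 0)
    (hW : ∀ n ω, W n ω = (if b n ω ≤ r then 1 else 0) - (if a n ω ≤ r then 1 else 0))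
    (hnd : ℙ {ω | a 1 ω ≤ r ∧ b 1 ω ≤ r} + ℙ {ω | r < a 1 ω ∧ r < b 1 ω} ≠ 0)
    (α : ℤ → Ω → ℝ)
    (hα : ∀ n ω, α n ω =
      ∑' j : ℕ, (∏ s ∈ Finset.range j, W (n - (s : ℤ) * d) ω) * U (n - (j : ℤ) * d) ω)
    (S : ℤ → Ω → ℝ)
    (hS : ∀ n ω, S n ω = a n ω + (b n ω - a n ω) * α (n - d) ω) :
    ∀ (n h : ℤ) (k : ℕ), 1 ≤ k →
      Measure.map (fun ω => fun i : Fin k => S (n + 1 + (i : ℤ) + h) ω) ℙ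
        = Measure.map (fun ω => fun i : Fin k => S (n + 1 + (i : ℤ)) ω) ℙ := by
  have hae : IsFactorProcess e a := by
    rw [funext₂ ha]
    exact .movingAverage e q μ2 ψ
  have hbe : IsFactorProcess e b := by
    rw [funext₂ hb]
    exact .movingAverage e q μ1 φ
  have hmeas : Measurable fun x : ℝ => if x ≤ r then (1 : ℝ) else 0 :=
    measurable_const.ite measurableSet_Iic measurable_const
  have hUe : IsFactorProcess e U := by
    rw [funext₂ hU]
    exact hae.comp₂ hae (hmeas.comp measurable_fst)
  have hWe : IsFactorProcess e W := by
    rw [funext₂ hW]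
    exact hae.comp₂ hbe ((hmeas.comp measurable_snd).sub (hmeas.comp measurable_fst))
  have hαe : IsFactorProcess e α := by
    rw [funext₂ hα]
    exact hUe.tsum_prod_mul hWe d
  have hdiff : IsFactorProcess e fun n ω => (b n ω - a n ω) * α (n - d) ω :=
    (hbe.comp₂ hae (measurable_fst.sub measurable_snd)).comp₂ (hαe.sub_const d)
      (measurable_fst.mul measurable_snd)
  have hSe : IsFactorProcess e S := by
    rw [funext₂ hS]
    exact hae.comp₂ hdiff (measurable_fst.add measurable_snd)
  intro n h k _
  exact hSe.map_shift_eq he hindep hident (fun i : Fin k => n + 1 + (i : ℤ)) h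
end

section
/- Assume the non-degeneracy condition P(a_1 ≤ r, b_1 ≤ r) + P(a_1 > r, b_1 > r) ≠ 0. Then the process S_n = a_n + (b_n − a_n)·α_{n−d} is ergodic: the pushforward law of the sequence (S_n)_{n ∈ ℤ} on ℝ^ℤ is invariant under the left shift map and the shift is ergodic with respect to this law. -/
open MeasureTheory ProbabilityTheory Filter Finset

open scoped symmDiff ENNReal

theorem iterate_leftShift {X : Type*} (N : ℕ) :
    (fun (x : ℤ → X) n => x (n + 1))^[N] = fun x n => x (n + N) := by
  induction N with
  | zero => funext x n; simp
  | succ N ih =>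
    rw [Function.iterate_succ', ih]
    funext x n
    simp only [Function.comp_apply]
    congr 1
    push_cast
    ring

theorem exists_disjoint_map_addRight (I : Finset ℤ) :
    ∃ N : ℕ, Disjoint I (I.map (addRightEmbedding (N : ℤ))) := by
  obtain ⟨u, hu⟩ := I.bddAbove
  obtain ⟨l, hl⟩ := I.bddBelow
  refine ⟨(u - l).toNat + 1, Finset.disjoint_left.2 fun i hi hi' => ?_⟩
  obtain ⟨j, hj, rfl⟩ := Finset.mem_map.1 hi'
  have h₁ := hu hi
  have h₂ := hl hj
  simp only [addRightEmbedding_apply] at h₁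
  push_cast at h₁
  have := Int.self_le_toNat (u - l)
  linarith

section BernoulliShift

variable {X : Type*} [MeasurableSpace X] (ν : Measure X) [IsProbabilityMeasure ν]

theorem measurePreserving_translate_infinitePi (k : ℤ) :
    MeasurePreserving (fun (x : ℤ → X) n => x (n + k))
      (Measure.infinitePi fun _ => ν) (Measure.infinitePi fun _ => ν) :=
  ⟨by fun_prop, Measure.map_infinitePi_infinitePi_of_inj (P := fun _ : ℤ => ν)
    (f := fun n : ℤ => n + k) (add_left_injective k)⟩

theorem exists_measureReal_cylinder_inter_translate {t : Set (ℤ → X)}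
    (ht : t ∈ measurableCylinders fun _ : ℤ => X) :
    ∃ N : ℕ, (Measure.infinitePi fun _ : ℤ => ν).real (t ∩ (fun x n => x (n + N)) ⁻¹' t) =
      (Measure.infinitePi fun _ : ℤ => ν).real t ^ 2 := by
  obtain ⟨I, C, hC, rfl⟩ := (mem_measurableCylinders t).1 ht
  obtain ⟨N, hN⟩ := exists_disjoint_map_addRight I
  refine ⟨N, ?_⟩
  set J := I.map (addRightEmbedding (N : ℤ))
  have hiJ (i : I) : (i : ℤ) + N ∈ J := Finset.mem_map_of_mem (addRightEmbedding (N : ℤ)) i.2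
  have hindep := (iIndepFun_infinitePi (P := fun _ : ℤ => ν) (X := fun _ x => x)
    fun _ => measurable_id).indepFun_finset I J hN fun _ => by fun_prop
  have hindep' := hindep.comp (φ := id) (ψ := fun y (i : I) => y ⟨i + N, hiJ i⟩)
    measurable_id (by fun_prop)
  have h := hindep'.measure_inter_preimage_eq_mul C C hC hC
  have hT := (measurePreserving_translate_infinitePi ν (N : ℤ)).measure_preimage
    (hC.cylinder I).nullMeasurableSet
  rw [pow_two, measureReal_def, measureReal_def, ← ENNReal.toReal_mul]
  congr 1
  exact h.trans (congrArg₂ (· * ·) rfl hT)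

/-- The shift on a two-sided product of copies of a probability space is ergodic. -/
theorem ergodic_leftShift_infinitePi :
    Ergodic (fun (x : ℤ → X) n => x (n + 1)) (Measure.infinitePi fun _ => ν) := by
  have hmp := measurePreserving_translate_infinitePi ν 1
  refine ⟨hmp, ⟨fun A hA hinv => ?_⟩⟩
  set μ : Measure (ℤ → X) := Measure.infinitePi fun _ => ν
  have key (ε : ℝ) (hε : 0 < ε) : |μ.real A - μ.real A ^ 2| ≤ 4 * ε := by
    obtain ⟨t, ht, htA⟩ := exists_measure_symmDiff_lt_of_generateFrom_isSetRing (μ := μ)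
      (isSetRing_measurableCylinders (α := fun _ : ℤ => X))
      ⟨{Set.univ}, Set.countable_singleton _,
        Set.singleton_subset_iff.2 (univ_mem_measurableCylinders _), by simp⟩
      generateFrom_measurableCylinders.symm hA (ENNReal.ofReal_pos.2 hε)
    have htm : MeasurableSet t := .of_mem_measurableCylinders ht
    have htA' : μ.real (t ∆ A) ≤ ε :=
      ENNReal.toReal_le_of_le_ofReal hε.le htA.le
    obtain ⟨N, hN⟩ := exists_measureReal_cylinder_inter_translate ν ht
    set T : (ℤ → X) → ℤ → X := fun x n => x (n + N) with hT
    have hTmp : MeasurePreserving T μ μ := measurePreserving_translate_infinitePi ν N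
    have hTA : T ⁻¹' A = A := by
      rw [hT, ← iterate_leftShift, Set.preimage_iterate_eq]
      exact Function.iterate_fixed hinv N
    have hTt : μ.real ((T ⁻¹' t) ∆ A) ≤ ε := by
      rw [← hTA, ← Set.preimage_symmDiff, measureReal_def,
        hTmp.measure_preimage (htm.symmDiff hA).nullMeasurableSet]
      simpa [measureReal_def] using htA'
    have hsub : (t ∩ T ⁻¹' t) ∆ A ⊆ t ∆ A ∪ (T ⁻¹' t) ∆ A := by
      intro x
      simp only [Set.mem_symmDiff, Set.mem_inter_iff, Set.mem_union]
      tauto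
    have h₁ := abs_measureReal_sub_le_measureReal_symmDiff (μ := μ) htm.nullMeasurableSet
      hA.nullMeasurableSet
    have h₂ := abs_measureReal_sub_le_measureReal_symmDiff (μ := μ)
      (htm.inter (hTmp.measurable htm)).nullMeasurableSet hA.nullMeasurableSet
    have h₃ : μ.real ((t ∩ T ⁻¹' t) ∆ A) ≤ 2 * ε := by
      have := (measureReal_mono (μ := μ) hsub).trans (measureReal_union_le _ _)
      linarith
    rw [hN] at h₂
    have hA0 : 0 ≤ μ.real A := measureReal_nonneg
    have hA1 : μ.real A ≤ 1 := measureReal_le_one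
    have ht0 : 0 ≤ μ.real t := measureReal_nonneg
    have ht1 : μ.real t ≤ 1 := measureReal_le_one
    rw [abs_le] at h₁ h₂ ⊢
    constructor <;> nlinarith
  have hzero : μ.real A - μ.real A ^ 2 = 0 := by
    by_contra hne
    have hpos := abs_pos.2 hne
    have := key (|μ.real A - μ.real A ^ 2| / 8) (by positivity)
    linarith
  have hcases : μ.real A = 0 ∨ μ.real A = 1 := by
    have : μ.real A * (1 - μ.real A) = 0 := by linarith
    rcases mul_eq_zero.1 this with h | h
    · exact .inl h
    · exact .inr (by linarith)
  rw [eventuallyConst_set']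
  rcases hcases with h | h
  · left
    exact ae_eq_empty.2 ((measureReal_eq_zero_iff).1 h)
  · right
    rw [ae_eq_univ, prob_compl_eq_zero_iff hA]
    simpa [measureReal_def, ENNReal.toReal_eq_one_iff] using h

end BernoulliShift


/-- Under the non-degeneracy condition, the process
`S_n = a_n + (b_n − a_n)·α_{n−d}` is ergodic: the pushforward law of the sequence
`(S_n)_{n∈ℤ}` on `ℝ^ℤ` is invariant under the left shift `(x_n) ↦ (x_{n+1})`, and
the shift is ergodic with respect to this law. -/
theorem tma_S_ergodic
    {Ω : Type*} [MeasureSpace Ω] [IsProbabilityMeasure (ℙ : Measure Ω)]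
    (e : ℤ → Ω → ℝ)
    (he : ∀ n, Measurable (e n))
    (hindep : iIndepFun e ℙ)
    (hident : ∀ n, Measure.map (e n) ℙ = Measure.map (e 0) ℙ)
    (q d : ℕ) (hq : 0 < q) (hd : 0 < d)
    (r μ1 μ2 : ℝ) (φ ψ : ℕ → ℝ)
    (a b U W : ℤ → Ω → ℝ)
    (ha : ∀ n ω, a n ω = μ2 + e n ω + ∑ i ∈ Finset.Icc 1 q, ψ i * e (n - i) ω)
    (hb : ∀ n ω, b n ω = μ1 + e n ω + ∑ i ∈ Finset.Icc 1 q, φ i * e (n - i) ω)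
    (hU : ∀ n ω, U n ω = if a n ω ≤ r then 1 else 0)
    (hW : ∀ n ω, W n ω = (if b n ω ≤ r then 1 else 0) - (if a n ω ≤ r then 1 else 0))
    (hnd : ℙ {ω | a 1 ω ≤ r ∧ b 1 ω ≤ r} + ℙ {ω | r < a 1 ω ∧ r < b 1 ω} ≠ 0)
    (α : ℤ → Ω → ℝ)
    (hα : ∀ n ω, α n ω =
      ∑' j : ℕ, (∏ s ∈ Finset.range j, W (n - (s : ℤ) * d) ω) * U (n - (j : ℤ) * d) ω)
    (S : ℤ → Ω → ℝ)
    (hS : ∀ n ω, S n ω = a n ω + (b n ω - a n ω) * α (n - d) ω) :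
    MeasurePreserving (fun x : ℤ → ℝ => fun n => x (n + 1))
        (Measure.map (fun ω => fun n : ℤ => S n ω) ℙ)
        (Measure.map (fun ω => fun n : ℤ => S n ω) ℙ) ∧
      Ergodic (fun x : ℤ → ℝ => fun n => x (n + 1))
        (Measure.map (fun ω => fun n : ℤ => S n ω) ℙ) := by
  have hΩ : Ergodic (fun (x : ℤ → ℝ) n => x (n + 1)) (Measure.map (fun ω n => e n ω) ℙ) := by
    have : IsProbabilityMeasure (Measure.map (e 0) ℙ) :=
      Measure.isProbabilityMeasure_map (he 0).aemeasurable
    rw [hindep.map_fun_eq_infinitePi_map he, funext hident]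
    exact ergodic_leftShift_infinitePi _
  let A (n : ℤ) (x : ℤ → ℝ) : ℝ := μ2 + x n + ∑ i ∈ Finset.Icc 1 q, ψ i * x (n - i)
  let B (n : ℤ) (x : ℤ → ℝ) : ℝ := μ1 + x n + ∑ i ∈ Finset.Icc 1 q, φ i * x (n - i)
  let u (n : ℤ) (x : ℤ → ℝ) : ℝ := if A n x ≤ r then 1 else 0
  let w (n : ℤ) (x : ℤ → ℝ) : ℝ := (if B n x ≤ r then 1 else 0) - (if A n x ≤ r then 1 else 0)
  let α' (n : ℤ) (x : ℤ → ℝ) : ℝ :=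
    ∑' j : ℕ, (∏ s ∈ Finset.range j, w (n - (s : ℤ) * d) x) * u (n - (j : ℤ) * d) x
  let G (x : ℤ → ℝ) (n : ℤ) : ℝ := A n x + (B n x - A n x) * α' (n - d) x
  have hAm (n : ℤ) : Measurable (A n) := by fun_prop
  have hBm (n : ℤ) : Measurable (B n) := by fun_prop
  have hum (n : ℤ) : Measurable (u n) :=
    .ite (measurableSet_le (hAm n) measurable_const) measurable_const measurable_const
  have hwm (n : ℤ) : Measurable (w n) :=
    (Measurable.ite (measurableSet_le (hBm n) measurable_const) measurable_const
      measurable_const).sub (hum n)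
  have hαm (n : ℤ) : Measurable (α' n) :=
    .tsum fun j => (Finset.measurable_prod _ fun s _ => hwm _).mul (hum _)
  have hGm : Measurable G :=
    measurable_pi_lambda _ fun n => (hAm n).add (((hBm n).sub (hAm n)).mul (hαm _))
  have hem : Measurable fun ω n => e n ω := measurable_pi_lambda _ he
  have hfactor : (fun ω (n : ℤ) => S n ω) = G ∘ fun ω n => e n ω := by
    funext ω n
    simp only [Function.comp_apply, G, α', u, w, A, B, hS, hα, hU, hW, ha, hb]
  have hcomm : Function.Semiconj G (fun x n => x (n + 1)) (fun x n => x (n + 1)) := by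
    intro x
    have hA (n : ℤ) : A n (fun n => x (n + 1)) = A (n + 1) x := by
      simp only [A, sub_add_eq_add_sub]
    have hB (n : ℤ) : B n (fun n => x (n + 1)) = B (n + 1) x := by
      simp only [B, sub_add_eq_add_sub]
    have hu (n : ℤ) : u n (fun n => x (n + 1)) = u (n + 1) x := by simp only [u, hA]
    have hw (n : ℤ) : w n (fun n => x (n + 1)) = w (n + 1) x := by simp only [w, hA, hB]
    have hα (n : ℤ) : α' n (fun n => x (n + 1)) = α' (n + 1) x := by
      simp only [α', hu, hw, sub_add_eq_add_sub]
    funext n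
    simp only [G, hA, hB, hα, sub_add_eq_add_sub]
  have hS_erg : Ergodic (fun (x : ℤ → ℝ) n => x (n + 1))
      (Measure.map (fun ω => fun n : ℤ => S n ω) ℙ) := by
    rw [hfactor, ← Measure.map_map hGm hem]
    exact (hGm.measurePreserving _).ergodic_of_ergodic_semiconj hΩ (by fun_prop) hcomm
  exact ⟨hS_erg.toMeasurePreserving, hS_erg⟩
end

section
/- Assume the non-degeneracy condition P(a_1 ≤ r, b_1 ≤ r) + P(a_1 > r, b_1 > r) ≠ 0 and E e_1² < ∞, and let {y_n} be the unique strictly stationary solution of the TMA(q) model. Then there exists a constant ρ ∈ (0,1) such that the autocovariances satisfy Cov(y_0, y_k) = O(ρ^k) as k → ∞; that is, there is a constant C > 0 with |Cov(y_0, y_k)| ≤ C·ρ^k for all k ≥ 1. Consequently the autocorrelation function ρ_k decays at an exponential rate. -/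
open MeasureTheory ProbabilityTheory Filter Finset

section Innovations

variable {Ω : Type*} {e : ℤ → Ω → ℝ}

/-- The σ-algebra generated by the innovations `e n` with `n ∈ S`. -/
abbrev innovationSigma (e : ℤ → Ω → ℝ) (S : Set ℤ) : MeasurableSpace Ω :=
  ⨆ n ∈ S, MeasurableSpace.comap (e n) inferInstance

lemma measurable_innovation {S : Set ℤ} {n : ℤ} (hn : n ∈ S) :
    Measurable[innovationSigma e S] (e n) :=
  Measurable.mono (comap_measurable (e n))
    (le_iSup₂ (f := fun m (_ : m ∈ S) => MeasurableSpace.comap (e m) inferInstance) n hn) le_rfl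

lemma innovationSigma_mono {S T : Set ℤ} (h : S ⊆ T) :
    innovationSigma e S ≤ innovationSigma e T :=
  biSup_mono h

variable [mΩ : MeasurableSpace Ω] {P : Measure Ω}

lemma innovationSigma_le (he : ∀ n, Measurable (e n)) (S : Set ℤ) : innovationSigma e S ≤ mΩ :=
  iSup₂_le fun n _ => (he n).comap_le

/-- Functionals of disjoint sets of innovations are independent. -/
lemma indepFun_of_disjoint_innovations (he : ∀ n, Measurable (e n)) (hindep : iIndepFun e P)
    {S T : Set ℤ} (hST : Disjoint S T) {f g : Ω → ℝ}
    (hf : Measurable[innovationSigma e S] f) (hg : Measurable[innovationSigma e T] g) :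
    IndepFun f g P := by
  rw [IndepFun_iff_Indep]
  exact indep_of_indep_of_le (indep_iSup_of_disjoint (fun n => (he n).comap_le) hindep hST)
    hf.comap_le hg.comap_le

/-- The law of the i.i.d. innovation sequence is invariant under time shifts. -/
lemma identDistrib_shift (he : ∀ n, Measurable (e n)) (hindep : iIndepFun e P)
    (hident : ∀ n, Measure.map (e n) P = Measure.map (e 0) P) (n : ℤ) :
    IdentDistrib (fun ω (i : ℤ) => e (n + i) ω) (fun ω (i : ℤ) => e i ω) P P :=
  IdentDistrib.pi (X := fun i => e (n + i)) (Y := e)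
    (fun i => ⟨(he _).aemeasurable, (he _).aemeasurable, by rw [hident, hident i]⟩)
    (hindep.precomp (add_right_injective n)) hindep

/-- Functionals of successive, disjoint blocks of innovations factor in expectation. -/
lemma integral_mul_prod_blocks (he : ∀ n, Measurable (e n)) (hindep : iIndepFun e P)
    {q L : ℕ} (hqL : q < L) {c : ℤ} {X : Ω → ℝ} {f : ℕ → Ω → ℝ} {p : ℝ}
    (hX : Measurable[innovationSigma e (Set.Ioi c)] X)
    (hf : ∀ i : ℕ, Measurable[innovationSigma e (Set.Icc (c - i * L - q) (c - i * L))] (f i))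
    (hp : ∀ i, ∫ ω, f i ω ∂P = p) (N : ℕ) :
    ∫ ω, X ω * ∏ i ∈ range N, f i ω ∂P = (∫ ω, X ω ∂P) * p ^ N := by
  have hmeas : ∀ N : ℕ, Measurable[innovationSigma e (Set.Ioi (c - N * L))]
      (fun ω => X ω * ∏ i ∈ range N, f i ω) := by
    intro N
    have hX' : Measurable[innovationSigma e (Set.Ioi (c - N * L))] X :=
      hX.mono (innovationSigma_mono (Set.Ioi_subset_Ioi (by
        have : (0 : ℤ) ≤ N * L := by positivity
        linarith))) le_rfl
    refine hX'.mul (Finset.measurable_prod _ fun i hi => ?_)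
    refine (hf i).mono (innovationSigma_mono fun x hx => ?_) le_rfl
    have hi' : (i : ℤ) + 1 ≤ N := by exact_mod_cast mem_range.1 hi
    have hqL' : (q : ℤ) < L := by exact_mod_cast hqL
    have := mul_le_mul_of_nonneg_right hi' (Int.natCast_nonneg L)
    simp only [Set.mem_Icc, Set.mem_Ioi] at hx ⊢
    linarith [hx.1]
  induction N with
  | zero => simp
  | succ N ih =>
    have hind : IndepFun (fun ω => X ω * ∏ i ∈ range N, f i ω) (f N) P := by
      refine indepFun_of_disjoint_innovations he hindep ?_ (hmeas N) (hf N)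
      rw [Set.disjoint_left]
      intro x hx hx'
      exact (not_lt.2 hx'.2) hx
    have h1 := (hmeas N).mono (innovationSigma_le he _) le_rfl
    have h2 := (hf N).mono (innovationSigma_le he _) le_rfl
    simp only [prod_range_succ, ← mul_assoc]
    rw [hind.integral_fun_mul_eq_mul_integral h1.aestronglyMeasurable h2.aestronglyMeasurable,
      ih, hp, pow_succ, mul_assoc]

end Innovations

section Covariance

variable {Ω : Type*} [MeasurableSpace Ω] {P : Measure Ω}

lemma abs_integral_mul_le_of_sq_le {f g : Ω → ℝ} (hf : MemLp f 2 P) (hg : MemLp g 2 P)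
    {t B : ℝ} (ht : 0 < t) (hB : ∫ ω, g ω ^ 2 ∂P ≤ t ^ 2 * B) :
    |∫ ω, f ω * g ω ∂P| ≤ t * ((∫ ω, f ω ^ 2 ∂P) + B) / 2 := by
  have hf2 := hf.integrable_sq
  have hg2 := hg.integrable_sq
  calc |∫ ω, f ω * g ω ∂P| ≤ ∫ ω, |f ω * g ω| ∂P := abs_integral_le_integral_abs
    _ ≤ ∫ ω, (t / 2 * f ω ^ 2 + 1 / (2 * t) * g ω ^ 2) ∂P := by
        refine integral_mono (hf.integrable_mul hg).abs
          ((hf2.const_mul _).add (hg2.const_mul _)) fun ω => ?_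
        have hid : t / 2 * f ω ^ 2 + 1 / (2 * t) * g ω ^ 2
            = ((t * |f ω| - |g ω|) ^ 2) / (2 * t) + |f ω| * |g ω| := by
          rw [← sq_abs (f ω), ← sq_abs (g ω)]
          field_simp
          ring
        simp only [abs_mul, hid]
        have : 0 ≤ ((t * |f ω| - |g ω|) ^ 2) / (2 * t) := by positivity
        linarith
    _ = t / 2 * (∫ ω, f ω ^ 2 ∂P) + 1 / (2 * t) * ∫ ω, g ω ^ 2 ∂P := by
        rw [integral_add (hf2.const_mul _) (hg2.const_mul _), integral_const_mul,
          integral_const_mul]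
    _ ≤ t / 2 * (∫ ω, f ω ^ 2 ∂P) + 1 / (2 * t) * (t ^ 2 * B) := by gcongr
    _ = t * ((∫ ω, f ω ^ 2 ∂P) + B) / 2 := by field_simp

/-- If `Y` is mean-square close to a variable `Z` independent of `X`, then the covariance of `X`
and `Y` is small. -/
lemma abs_covariance_le_of_indepFun_approx [IsProbabilityMeasure P] {X Y Z : Ω → ℝ}
    (hX : MemLp X 2 P) (hY : MemLp Y 2 P) (hZ : MemLp Z 2 P) (hXZ : IndepFun X Z P)
    {t B : ℝ} (ht : 0 < t) (hB : ∫ ω, (Y ω - Z ω) ^ 2 ∂P ≤ t ^ 2 * B) :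
    |∫ ω, (X ω - ∫ x, X x ∂P) * (Y ω - ∫ x, Y x ∂P) ∂P|
      ≤ t * ((∫ ω, (X ω - ∫ x, X x ∂P) ^ 2 ∂P) + B) / 2 := by
  set m := ∫ x, X x ∂P with hm
  set m' := ∫ x, Y x ∂P
  have hXc : MemLp (fun ω => X ω - m) 2 P := hX.sub (memLp_const m)
  have hX1 : Integrable X P := hX.integrable one_le_two
  have hmean : ∫ ω, (X ω - m) ∂P = 0 := by
    rw [integral_sub hX1 (integrable_const m), integral_const]
    simp [hm]
  have hindep : ∫ ω, (X ω - m) * Z ω ∂P = 0 := by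
    have h : IndepFun (fun ω => X ω - m) Z P :=
      hXZ.comp (φ := fun x => x - m) (ψ := id) (by fun_prop) measurable_id
    rw [h.integral_fun_mul_eq_mul_integral hXc.1 hZ.1, hmean, zero_mul]
  have hsplit : ∫ ω, (X ω - m) * (Y ω - m') ∂P = ∫ ω, (X ω - m) * (Y ω - Z ω) ∂P := by
    have h1 : Integrable (fun ω => (X ω - m) * (Y ω - Z ω)) P := hXc.integrable_mul (hY.sub hZ)
    have h2 : Integrable (fun ω => (X ω - m) * Z ω) P := hXc.integrable_mul hZ
    have h3 : Integrable (fun ω => (X ω - m) * m') P := (hXc.integrable one_le_two).mul_const m'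
    have h12 : Integrable (fun ω => (X ω - m) * (Y ω - Z ω) + (X ω - m) * Z ω) P := h1.add h2
    calc ∫ ω, (X ω - m) * (Y ω - m') ∂P
        = ∫ ω, ((X ω - m) * (Y ω - Z ω) + (X ω - m) * Z ω - (X ω - m) * m') ∂P := by
          congr 1 with ω
          ring
      _ = _ := by
          rw [integral_sub h12 h3, integral_add h1 h2, integral_mul_const, hindep, hmean]
          ring
  rw [hsplit]
  exact abs_integral_mul_le_of_sq_le hXc (hY.sub hZ) ht hB

end Covariance

section ThresholdSeries

variable {u w : ℕ → ℝ}

lemma thresholdSum_mem_Icc (hu : ∀ i, u i ∈ Set.Icc (0 : ℝ) 1)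
    (huw : ∀ i, u i + w i ∈ Set.Icc (0 : ℝ) 1) (m : ℕ) :
    ∑ j ∈ range m, (∏ s ∈ range j, w s) * u j ∈ Set.Icc (0 : ℝ) 1 := by
  induction m generalizing u w with
  | zero => simp
  | succ m ih =>
    have hrec : ∑ j ∈ range (m + 1), (∏ s ∈ range j, w s) * u j
        = u 0 + w 0 * ∑ j ∈ range m, (∏ s ∈ range j, w (s + 1)) * u (j + 1) := by
      rw [sum_range_succ', mul_sum]
      simp only [prod_range_succ', prod_range_zero]
      rw [add_comm, one_mul]
      congr 1
      exact sum_congr rfl fun j _ => by ring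
    obtain ⟨h0, h1⟩ := ih (fun i => hu (i + 1)) (fun i => huw (i + 1))
    rw [hrec]
    set S := ∑ j ∈ range m, (∏ s ∈ range j, w (s + 1)) * u (j + 1)
    obtain ⟨hu0, hu1⟩ := hu 0
    obtain ⟨hv0, hv1⟩ := huw 0
    constructor <;>
      nlinarith [mul_nonneg hv0 h0, mul_nonneg hu0 (sub_nonneg.2 h1),
        mul_nonneg (sub_nonneg.2 hv1) h0, mul_nonneg (sub_nonneg.2 hu1) (sub_nonneg.2 h1)]

lemma thresholdSeries_mem_Icc (hu : ∀ i, u i ∈ Set.Icc (0 : ℝ) 1)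
    (huw : ∀ i, u i + w i ∈ Set.Icc (0 : ℝ) 1) :
    ∑' j, (∏ s ∈ range j, w s) * u j ∈ Set.Icc (0 : ℝ) 1 := by
  by_cases hs : Summable fun j => (∏ s ∈ range j, w s) * u j
  · exact isClosed_Icc.mem_of_tendsto hs.hasSum.tendsto_sum_nat
      (Eventually.of_forall fun m => thresholdSum_mem_Icc hu huw m)
  · simp [tsum_eq_zero_of_not_summable hs]

lemma thresholdSeries_eq_sum {m s : ℕ} (hs : s < m) (hw : w s = 0) :
    ∑' j, (∏ s ∈ range j, w s) * u j = ∑ j ∈ range m, (∏ s ∈ range j, w s) * u j := by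
  refine tsum_eq_sum fun j hj => ?_
  rw [prod_eq_zero (mem_range.2 (hs.trans_le (by simpa using hj))) hw, zero_mul]

/-- Truncating the threshold series costs at most the indicator that none of the selected weights
vanishes. -/
lemma sq_thresholdSeries_sub_sum_le (hu : ∀ i, u i ∈ Set.Icc (0 : ℝ) 1)
    (huw : ∀ i, u i + w i ∈ Set.Icc (0 : ℝ) 1) {m N : ℕ} {s : ℕ → ℕ} (hs : ∀ i < N, s i < m) :
    ((∑' j, (∏ s ∈ range j, w s) * u j) - ∑ j ∈ range m, (∏ s ∈ range j, w s) * u j) ^ 2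
      ≤ ∏ i ∈ range N, if w (s i) = 0 then (0 : ℝ) else 1 := by
  by_cases h : ∃ i < N, w (s i) = 0
  · obtain ⟨i, hi, hw⟩ := h
    rw [thresholdSeries_eq_sum (hs i hi) hw, sub_self]
    have : ∀ i ∈ range N, (0 : ℝ) ≤ if w (s i) = 0 then (0 : ℝ) else 1 := fun i _ => by
      split_ifs <;> norm_num
    simpa using prod_nonneg this
  · push Not at h
    rw [prod_congr rfl fun i hi => if_neg (h i (mem_range.1 hi)), prod_const_one]
    obtain ⟨h0, h1⟩ := thresholdSeries_mem_Icc hu huw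
    obtain ⟨h2, h3⟩ := thresholdSum_mem_Icc hu huw m
    rw [sq_le_one_iff_abs_le_one, abs_le]
    constructor <;> linarith

end ThresholdSeries

/-- A bound that decays geometrically in a block index which advances every `M` steps
is geometric in time. -/
lemma exists_geometric_bound {c : ℕ → ℝ} {θ K : ℝ} (hθ : θ ∈ Set.Ioo (0 : ℝ) 1) {M : ℕ}
    (hM : 0 < M) (h : ∀ k N : ℕ, N = 0 ∨ (N + 1) * M ≤ k → c k ≤ K * θ ^ N) :
    ∃ ρ ∈ Set.Ioo (0 : ℝ) 1, ∃ C > (0 : ℝ), ∀ k, c k ≤ C * ρ ^ k := by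
  obtain ⟨hθ0, hθ1⟩ := hθ
  have hM' : (M : ℝ) ≠ 0 := by positivity
  set ρ := θ ^ (1 / (M : ℝ)) with hρ
  have hρ0 : 0 < ρ := Real.rpow_pos_of_pos hθ0 _
  have hρ1 : ρ < 1 := Real.rpow_lt_one hθ0.le hθ1 (by positivity)
  have hρM : ρ ^ M = θ := by
    rw [hρ, one_div, Real.rpow_inv_natCast_pow hθ0.le hM.ne']
  refine ⟨ρ, ⟨hρ0, hρ1⟩, (|K| + 1) / θ ^ 2, by positivity, fun k => ?_⟩
  set N := k / M - 1 with hN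
  have hNk : N = 0 ∨ (N + 1) * M ≤ k := by
    rcases Nat.eq_zero_or_pos (k / M) with h0 | h0
    · exact Or.inl (by omega)
    · exact Or.inr (by rw [hN, Nat.sub_add_cancel h0]; exact Nat.div_mul_le_self k M)
  have hkN : k ≤ M * (N + 2) := by
    have h1 : k < M * (k / M + 1) := Nat.lt_mul_div_succ k hM
    exact h1.le.trans (Nat.mul_le_mul_left M (by omega))
  have hpow : θ ^ (N + 2) ≤ ρ ^ k := by
    rw [← hρM, ← pow_mul]
    exact pow_le_pow_of_le_one hρ0.le hρ1.le hkN
  calc c k ≤ K * θ ^ N := h k N hNk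
    _ ≤ (|K| + 1) * θ ^ N := by gcongr; linarith [le_abs_self K]
    _ = (|K| + 1) / θ ^ 2 * θ ^ (N + 2) := by field_simp; ring
    _ ≤ (|K| + 1) / θ ^ 2 * ρ ^ k := by gcongr

/-- Theorem 3.1: Under the non-degeneracy condition and
`E e₁² < ∞`, the unique strictly stationary solution
`y_n = a_n + (b_n − a_n)·α_{n−d}` of the TMA(q) model has autocovariances
decaying at an exponential rate: there exist `ρ ∈ (0,1)` and `C > 0` with
`|Cov(y_0, y_k)| ≤ C·ρ^k` for all `k ≥ 1`. -/
theorem tma_acf_exponential_decay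
    {Ω : Type*} [MeasureSpace Ω] [IsProbabilityMeasure (ℙ : Measure Ω)]
    (e : ℤ → Ω → ℝ)
    (he : ∀ n, Measurable (e n))
    (hindep : iIndepFun e ℙ)
    (hident : ∀ n, Measure.map (e n) ℙ = Measure.map (e 0) ℙ)
    (q d : ℕ) (hq : 0 < q) (hd : 0 < d)
    (r μ1 μ2 : ℝ) (φ ψ : ℕ → ℝ)
    (a b U W : ℤ → Ω → ℝ)
    (ha : ∀ n ω, a n ω = μ2 + e n ω + ∑ i ∈ Finset.Icc 1 q, ψ i * e (n - i) ω)
    (hb : ∀ n ω, b n ω = μ1 + e n ω + ∑ i ∈ Finset.Icc 1 q, φ i * e (n - i) ω)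
    (hU : ∀ n ω, U n ω = if a n ω ≤ r then 1 else 0)
    (hW : ∀ n ω, W n ω = (if b n ω ≤ r then 1 else 0) - (if a n ω ≤ r then 1 else 0))
    (hnd : ℙ {ω | a 1 ω ≤ r ∧ b 1 ω ≤ r} + ℙ {ω | r < a 1 ω ∧ r < b 1 ω} ≠ 0)
    (hmom : Integrable (fun ω => (e 1 ω) ^ 2) ℙ)
    (α : ℤ → Ω → ℝ)
    (hα : ∀ n ω, α n ω =
      ∑' j : ℕ, (∏ s ∈ Finset.range j, W (n - (s : ℤ) * d) ω) * U (n - (j : ℤ) * d) ω)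
    (y : ℤ → Ω → ℝ)
    (hy : ∀ n ω, y n ω = a n ω + (b n ω - a n ω) * α (n - d) ω) :
    ∃ ρ ∈ Set.Ioo (0 : ℝ) 1, ∃ C > (0 : ℝ), ∀ k : ℕ, 1 ≤ k →
      |∫ ω, (y 0 ω - ∫ x, y 0 x ∂ℙ) * (y (k : ℤ) ω - ∫ x, y (k : ℤ) x ∂ℙ) ∂ℙ|
        ≤ C * ρ ^ k := by
  set I : ℤ → Ω → ℝ := fun n ω => if W n ω = 0 then 0 else 1 with hI
  set p : ℝ := ∫ ω, I 0 ω ∂ℙ with hp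
  have hUmem : ∀ n ω, U n ω ∈ Set.Icc (0 : ℝ) 1 := fun n ω => by
    rw [hU]; split_ifs <;> simp
  have hUWmem : ∀ n ω, U n ω + W n ω ∈ Set.Icc (0 : ℝ) 1 := fun n ω => by
    rw [hU, hW]; split_ifs <;> simp
  have hImem : ∀ n ω, I n ω ∈ Set.Icc (0 : ℝ) 1 := fun n ω => by
    simp only [hI]; split_ifs <;> simp
  -- Each variable is measurable with respect to the innovations in its window.
  have hwin : ∀ {n : ℤ} {S : Set ℤ}, Set.Icc (n - q) n ⊆ S → ∀ c : ℕ → ℝ, ∀ μ : ℝ,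
      Measurable[innovationSigma e S]
        (fun ω => μ + e n ω + ∑ i ∈ Finset.Icc 1 q, c i * e (n - i) ω) := by
    intro n S hS c μ
    refine (measurable_const.add (measurable_innovation (hS ?_))).add
      (Finset.measurable_sum _ fun i hi => (measurable_innovation (hS ?_)).const_mul _)
    · simp
    · rw [Finset.mem_Icc] at hi
      simp only [Set.mem_Icc]
      omega
  have hma : ∀ {n : ℤ} {S : Set ℤ}, Set.Icc (n - q) n ⊆ S →
      Measurable[innovationSigma e S] (a n) := fun {n S} hS => by
    rw [show a n = _ from funext (ha n)]; exact hwin hS ψ μ2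
  have hmb : ∀ {n : ℤ} {S : Set ℤ}, Set.Icc (n - q) n ⊆ S →
      Measurable[innovationSigma e S] (b n) := fun {n S} hS => by
    rw [show b n = _ from funext (hb n)]; exact hwin hS φ μ1
  have hmU : ∀ {n : ℤ} {S : Set ℤ}, Set.Icc (n - q) n ⊆ S →
      Measurable[innovationSigma e S] (U n) := fun {n S} hS => by
    rw [show U n = _ from funext (hU n)]
    exact Measurable.ite (measurableSet_le (hma hS) measurable_const) measurable_const
      measurable_const
  have hmW : ∀ {n : ℤ} {S : Set ℤ}, Set.Icc (n - q) n ⊆ S →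
      Measurable[innovationSigma e S] (W n) := fun {n S} hS => by
    rw [show W n = _ from funext (hW n)]
    exact (Measurable.ite (measurableSet_le (hmb hS) measurable_const) measurable_const
      measurable_const).sub (Measurable.ite (measurableSet_le (hma hS) measurable_const)
      measurable_const measurable_const)
  have hmI : ∀ {n : ℤ} {S : Set ℤ}, Set.Icc (n - q) n ⊆ S →
      Measurable[innovationSigma e S] (I n) := fun {n S} hS =>
    Measurable.ite (hmW hS (measurableSet_singleton 0)) measurable_const measurable_const
  have hmterm : ∀ {n : ℤ} {S : Set ℤ} (j : ℕ), Set.Icc (n - j * d - q) n ⊆ S →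
      Measurable[innovationSigma e S]
        (fun ω => (∏ s ∈ Finset.range j, W (n - (s : ℤ) * d) ω) * U (n - (j : ℤ) * d) ω) := by
    intro n S j hS
    refine (Finset.measurable_prod _ fun s hs => hmW ?_).mul (hmU ?_) <;>
      refine Set.Subset.trans (Set.Icc_subset_Icc ?_ ?_) hS
    · have : (s : ℤ) * d ≤ j * d := by
        exact_mod_cast Nat.mul_le_mul_right d (mem_range.1 hs).le
      linarith
    · have : (0 : ℤ) ≤ s * d := by positivity
      linarith
    · exact le_rfl
    · have : (0 : ℤ) ≤ j * d := by positivity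
      linarith
  have hmα : ∀ {n : ℤ} {S : Set ℤ}, Set.Iic n ⊆ S →
      Measurable[innovationSigma e S] (α n) := fun {n S} hS => by
    rw [show α n = _ from funext (hα n)]
    exact @Measurable.tsum _ _ _ (innovationSigma e S) _ _ _ _ _ _ _ _ _ _ _ _
      fun j => hmterm j (Set.Icc_subset_Iic_self.trans hS)
  have hmy : ∀ {n : ℤ} {S : Set ℤ}, Set.Iic n ⊆ S →
      Measurable[innovationSigma e S] (y n) := fun {n S} hS => by
    rw [show y n = _ from funext (hy n)]
    have h : Set.Icc (n - q) n ⊆ S := Set.Icc_subset_Iic_self.trans hS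
    exact (hma h).add (((hmb h).sub (hma h)).mul
      (hmα ((Set.Iic_subset_Iic.2 (by omega)).trans hS)))
  have hle : ∀ {S : Set ℤ} {f : Ω → ℝ}, Measurable[innovationSigma e S] f → Measurable f :=
    fun hf => hf.mono (innovationSigma_le he _) le_rfl
  -- Stationarity of the moving averages.
  let filt : (ℕ → ℝ) → ℝ → (ℤ → ℝ) → ℝ :=
    fun c μ v => μ + v 0 + ∑ i ∈ Finset.Icc 1 q, c i * v (-i)
  have hfilt : ∀ c μ, Measurable (filt c μ) := fun c μ => by fun_prop
  have haf : ∀ n ω, a n ω = filt ψ μ2 (fun i => e (n + i) ω) := fun n ω => by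
    simp [filt, ha, sub_eq_add_neg]
  have hbf : ∀ n ω, b n ω = filt φ μ1 (fun i => e (n + i) ω) := fun n ω => by
    simp [filt, hb, sub_eq_add_neg]
  have hstat : ∀ G : ℝ × ℝ → ℝ, Measurable G → ∀ n,
      ∫ ω, G (a n ω, b n ω) ∂ℙ = ∫ ω, G (a 0 ω, b 0 ω) ∂ℙ := by
    intro G hG n
    have key : ∀ n, ∫ ω, G (a n ω, b n ω) ∂ℙ
        = ∫ ω, G (filt ψ μ2 (fun i => e i ω), filt φ μ1 (fun i => e i ω)) ∂ℙ := fun n => by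
      simp only [haf, hbf]
      exact ((identDistrib_shift he hindep hident n).comp
        (hG.comp ((hfilt ψ μ2).prodMk (hfilt φ μ1)))).integral_eq
    rw [key, key]
  have hpn : ∀ n, ∫ ω, I n ω ∂ℙ = p := by
    intro n
    have hmeas : Measurable fun x : ℝ × ℝ =>
        if (if x.2 ≤ r then (1 : ℝ) else 0) - (if x.1 ≤ r then 1 else 0) = 0 then (0 : ℝ)
          else 1 := by
      have h1 : Measurable fun x : ℝ × ℝ =>
          (if x.2 ≤ r then (1 : ℝ) else 0) - (if x.1 ≤ r then 1 else 0) :=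
        (Measurable.ite (measurableSet_le measurable_snd measurable_const) measurable_const
          measurable_const).sub (Measurable.ite (measurableSet_le measurable_fst measurable_const)
          measurable_const measurable_const)
      exact Measurable.ite (h1 (measurableSet_singleton 0)) measurable_const measurable_const
    simpa only [hp, hI, hW] using hstat _ hmeas n
  have hp0 : 0 ≤ p := integral_nonneg fun ω => (hImem 0 ω).1
  have hp1 : p < 1 := by
    set A : Set Ω := {ω | W 1 ω = 0}
    have hA : MeasurableSet A := hle (hmW subset_rfl) (measurableSet_singleton 0)
    have hpos : ℙ A ≠ 0 := fun h0 => hnd <| by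
      have h1 : ℙ {ω | a 1 ω ≤ r ∧ b 1 ω ≤ r} = 0 := measure_mono_null (fun ω hω => by
        simp [A, hW, hω.1, hω.2]) h0
      have h2 : ℙ {ω | r < a 1 ω ∧ r < b 1 ω} = 0 := measure_mono_null (fun ω hω => by
        simp [A, hW, hω.1.not_ge, hω.2.not_ge]) h0
      rw [h1, h2, add_zero]
    have hIA : I 1 = Aᶜ.indicator 1 := by
      ext ω
      by_cases h : W 1 ω = 0 <;> simp [hI, A, h]
    rw [← hpn 1, hIA, integral_indicator_one hA.compl, probReal_compl_eq_one_sub hA]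
    have : 0 < (ℙ : Measure Ω).real A := ENNReal.toReal_pos hpos (measure_ne_top _ _)
    linarith
  -- Uniform second moment bounds.
  have he2 : ∀ n, MemLp (e n) 2 ℙ := fun n => by
    have h1 : MemLp (e 1) 2 ℙ :=
      (memLp_two_iff_integrable_sq (he 1).aestronglyMeasurable).2 hmom
    exact IdentDistrib.memLp_snd
      ⟨(he 1).aemeasurable, (he n).aemeasurable, by rw [hident, hident n]⟩ h1
  have hfilt2 : ∀ (n : ℤ) (c : ℕ → ℝ) (μ : ℝ),
      MemLp (fun ω => μ + e n ω + ∑ i ∈ Finset.Icc 1 q, c i * e (n - i) ω) 2 ℙ := fun n c μ =>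
    ((memLp_const μ).add (he2 n)).add (memLp_finsetSum _ fun i _ => (he2 _).const_mul _)
  have ha2 : ∀ n, MemLp (a n) 2 ℙ := fun n => by
    rw [show a n = _ from funext (ha n)]; exact hfilt2 n ψ μ2
  have hb2 : ∀ n, MemLp (b n) 2 ℙ := fun n => by
    rw [show b n = _ from funext (hb n)]; exact hfilt2 n φ μ1
  have hba2 : ∀ n, MemLp (fun ω => b n ω - a n ω) 2 ℙ := fun n => (hb2 n).sub (ha2 n)
  set D : ℝ := ∫ ω, (b 0 ω - a 0 ω) ^ 2 ∂ℙ with hD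
  set B : ℝ := 2 * (∫ ω, a 0 ω ^ 2 ∂ℙ) + 2 * D with hB
  have hDn : ∀ n, ∫ ω, (b n ω - a n ω) ^ 2 ∂ℙ = D :=
    hstat (fun x => (x.2 - x.1) ^ 2) (by fun_prop)
  have han : ∀ n, ∫ ω, a n ω ^ 2 ∂ℙ = ∫ ω, a 0 ω ^ 2 ∂ℙ := hstat (fun x => x.1 ^ 2) (by fun_prop)
  have hD0 : 0 ≤ D := integral_nonneg fun ω => sq_nonneg _
  have hDB : D ≤ B := by
    have : 0 ≤ ∫ ω, a 0 ω ^ 2 ∂ℙ := integral_nonneg fun ω => sq_nonneg _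
    linarith
  have hmix : ∀ (n : ℤ) (c : Ω → ℝ), Measurable c → (∀ ω, c ω ∈ Set.Icc (0 : ℝ) 1) →
      MemLp (fun ω => a n ω + (b n ω - a n ω) * c ω) 2 ℙ ∧
        ∫ ω, (a n ω + (b n ω - a n ω) * c ω) ^ 2 ∂ℙ ≤ B := by
    intro n c hc hc01
    have hdom : Integrable (fun ω => 2 * a n ω ^ 2 + 2 * (b n ω - a n ω) ^ 2) ℙ :=
      ((ha2 n).integrable_sq.const_mul 2).add ((hba2 n).integrable_sq.const_mul 2)
    have hpt : ∀ ω, (a n ω + (b n ω - a n ω) * c ω) ^ 2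
        ≤ 2 * a n ω ^ 2 + 2 * (b n ω - a n ω) ^ 2 := fun ω => by
      have h1 : ((b n ω - a n ω) * c ω) ^ 2 ≤ (b n ω - a n ω) ^ 2 := by
        rw [mul_pow]
        exact mul_le_of_le_one_right (sq_nonneg _) (pow_le_one₀ (hc01 ω).1 (hc01 ω).2)
      nlinarith [sq_nonneg (a n ω - (b n ω - a n ω) * c ω)]
    have hm : Measurable (fun ω => a n ω + (b n ω - a n ω) * c ω) :=
      (hle (hma subset_rfl)).add
        (((hle (hmb subset_rfl)).sub (hle (hma subset_rfl))).mul hc)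
    have hint : Integrable (fun ω => (a n ω + (b n ω - a n ω) * c ω) ^ 2) ℙ :=
      hdom.mono' (hm.pow_const 2).aestronglyMeasurable (Eventually.of_forall fun ω => by
        rw [Real.norm_of_nonneg (sq_nonneg _)]; exact hpt ω)
    refine ⟨(memLp_two_iff_integrable_sq hm.aestronglyMeasurable).2 hint, ?_⟩
    calc _ ≤ ∫ ω, (2 * a n ω ^ 2 + 2 * (b n ω - a n ω) ^ 2) ∂ℙ := integral_mono hint hdom hpt
      _ = B := by
        rw [integral_add ((ha2 n).integrable_sq.const_mul 2)
          ((hba2 n).integrable_sq.const_mul 2), integral_const_mul, integral_const_mul, hDn, han]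
  have hαmem : ∀ n ω, α n ω ∈ Set.Icc (0 : ℝ) 1 := fun n ω => by
    rw [hα]
    exact thresholdSeries_mem_Icc (u := fun j => U (n - (j : ℤ) * d) ω)
      (w := fun s => W (n - (s : ℤ) * d) ω) (fun i => hUmem _ ω) (fun i => hUWmem _ ω)
  have hymix : ∀ n, MemLp (y n) 2 ℙ ∧ ∫ ω, y n ω ^ 2 ∂ℙ ≤ B := fun n => by
    rw [show y n = _ from funext (hy n)]
    exact hmix n _ (hle (hmα subset_rfl)) (hαmem _)
  -- Comparison of the process with its truncation.
  obtain ⟨θ, hθ, hpθ⟩ : ∃ θ ∈ Set.Ioo (0 : ℝ) 1, p ≤ θ ^ 2 := by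
    refine ⟨max (Real.sqrt p) (1 / 2), ⟨by positivity, max_lt ?_ (by norm_num)⟩, ?_⟩
    · exact (Real.sqrt_lt' one_pos).2 (by simpa using hp1)
    · calc p = Real.sqrt p ^ 2 := (Real.sq_sqrt hp0).symm
        _ ≤ _ := by gcongr; exact le_max_left _ _
  set L : ℕ := (q + 1) * d with hL
  have hqL : q < L := (Nat.lt_succ_self q).trans_le (Nat.le_mul_of_pos_right _ hd)
  have hcov : ∀ k N : ℕ, N = 0 ∨ (N + 1) * (L + d + q) ≤ k →
      |∫ ω, (y 0 ω - ∫ x, y 0 x ∂ℙ) * (y (k : ℤ) ω - ∫ x, y (k : ℤ) x ∂ℙ) ∂ℙ|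
        ≤ (((∫ ω, (y 0 ω - ∫ x, y 0 x ∂ℙ) ^ 2 ∂ℙ) + B) / 2) * θ ^ N := by
    intro k N hN
    rw [mul_comm, ← mul_div_assoc]
    rcases hN with rfl | hN
    · exact abs_covariance_le_of_indepFun_approx (Z := fun _ => 0) (hymix 0).1 (hymix k).1
        (memLp_const 0) (indepFun_const_right _ _) (by simp) (by simpa using (hymix k).2)
    set m : ℕ := N * (q + 1) + 1 with hm
    set T : Ω → ℝ := fun ω => ∑ j ∈ Finset.range m,
      (∏ s ∈ Finset.range j, W ((k : ℤ) - d - (s : ℤ) * d) ω) *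
        U ((k : ℤ) - d - (j : ℤ) * d) ω with hT
    have hTmem : ∀ ω, T ω ∈ Set.Icc (0 : ℝ) 1 := fun ω =>
      thresholdSum_mem_Icc (u := fun j => U ((k : ℤ) - d - (j : ℤ) * d) ω)
        (w := fun s => W ((k : ℤ) - d - (s : ℤ) * d) ω) (fun i => hUmem _ ω)
        (fun i => hUWmem _ ω) m
    have hNZ : ((N : ℤ) + 1) * (L + d + q) ≤ k := by exact_mod_cast hN
    have hLpos : (0 : ℤ) < L := by exact_mod_cast (Nat.zero_le q).trans_lt hqL
    have hqLZ : (q : ℤ) < L := by exact_mod_cast hqL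
    have hNd : (0 : ℤ) ≤ N * d := by positivity
    have hNq : (0 : ℤ) ≤ N * q := by positivity
    have hNL : (0 : ℤ) ≤ N * L := by positivity
    have hTmeas : Measurable[innovationSigma e (Set.Ioi 0)] T := by
      refine Finset.measurable_sum _ fun j hj => hmterm j fun x hx => ?_
      have hj' : (j : ℤ) * d ≤ N * L := by
        have : j * d ≤ N * L := by
          rw [hL, ← mul_assoc]
          exact Nat.mul_le_mul_right d (Nat.lt_succ_iff.1 (mem_range.1 hj))
        exact_mod_cast this
      simp only [Set.mem_Icc, Set.mem_Ioi] at hx ⊢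
      nlinarith [hx.1]
    have hwk : Set.Icc ((k : ℤ) - q) k ⊆ Set.Ioi 0 := fun x hx => by
      simp only [Set.mem_Icc, Set.mem_Ioi] at hx ⊢
      nlinarith [hx.1]
    have hZmeas : Measurable[innovationSigma e (Set.Ioi 0)]
        (fun ω => a k ω + (b k ω - a k ω) * T ω) :=
      (hma hwk).add (((hmb hwk).sub (hma hwk)).mul hTmeas)
    refine abs_covariance_le_of_indepFun_approx (hymix 0).1 (hymix k).1
      (hmix k T (hle hTmeas) hTmem).1 (indepFun_of_disjoint_innovations he hindep
        (Set.Iic_disjoint_Ioi le_rfl) (hmy subset_rfl) hZmeas) (pow_pos hθ.1 N) ?_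
    have hpt : ∀ ω, (y k ω - (a k ω + (b k ω - a k ω) * T ω)) ^ 2
        ≤ (b k ω - a k ω) ^ 2 * ∏ i ∈ Finset.range N, I ((k : ℤ) - d - L - (i : ℤ) * L) ω := by
      intro ω
      have h := sq_thresholdSeries_sub_sum_le (u := fun j => U ((k : ℤ) - d - (j : ℤ) * d) ω)
        (w := fun s => W ((k : ℤ) - d - (s : ℤ) * d) ω) (fun i => hUmem _ ω)
        (fun i => hUWmem _ ω) (m := m) (N := N) (s := fun i => (i + 1) * (q + 1))
        (fun i hi => Nat.lt_succ_iff.2 (Nat.mul_le_mul_right _ hi))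
      rw [← hα] at h
      calc _ = (b k ω - a k ω) ^ 2 * (α (k - d) ω - T ω) ^ 2 := by rw [hy]; ring
        _ ≤ _ := by
          refine (mul_le_mul_of_nonneg_left h (sq_nonneg _)).trans_eq ?_
          congr 1
          refine prod_congr rfl fun i _ => ?_
          have hidx : (k : ℤ) - d - (((i + 1) * (q + 1) : ℕ) : ℤ) * d
              = (k : ℤ) - d - L - (i : ℤ) * L := by
            rw [hL]; push_cast; ring
          simp only [hI, hidx]
    have hXm : Measurable[innovationSigma e (Set.Ioi ((k : ℤ) - d - L))]
        (fun ω => (b k ω - a k ω) ^ 2) := by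
      have hS : Set.Icc ((k : ℤ) - q) k ⊆ Set.Ioi ((k : ℤ) - d - L) := fun x hx => by
        simp only [Set.mem_Icc, Set.mem_Ioi] at hx ⊢
        omega
      exact ((hmb hS).sub (hma hS)).pow_const 2
    have hblocks := integral_mul_prod_blocks (P := ℙ) he hindep hqL hXm
      (fun i => hmI subset_rfl) (fun i => hpn _) N
    have hPm : Measurable fun ω =>
        ∏ i ∈ Finset.range N, I ((k : ℤ) - d - L - (i : ℤ) * L) ω :=
      Finset.measurable_prod _ fun i _ => hle (hmI subset_rfl)
    have hdomint : Integrable (fun ω => (b k ω - a k ω) ^ 2 *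
        ∏ i ∈ Finset.range N, I ((k : ℤ) - d - L - (i : ℤ) * L) ω) ℙ := by
      refine (hba2 k).integrable_sq.mono' ((hle hXm).mul hPm).aestronglyMeasurable
        (Eventually.of_forall fun ω => ?_)
      have h0 : 0 ≤ ∏ i ∈ Finset.range N, I ((k : ℤ) - d - L - (i : ℤ) * L) ω :=
        prod_nonneg fun i _ => (hImem _ ω).1
      rw [Real.norm_of_nonneg (mul_nonneg (sq_nonneg _) h0)]
      exact mul_le_of_le_one_right (sq_nonneg _)
        (prod_le_one (fun i _ => (hImem _ ω).1) fun i _ => (hImem _ ω).2)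
    calc ∫ ω, (y k ω - (a k ω + (b k ω - a k ω) * T ω)) ^ 2 ∂ℙ
        ≤ ∫ ω, (b k ω - a k ω) ^ 2 *
            ∏ i ∈ Finset.range N, I ((k : ℤ) - d - L - (i : ℤ) * L) ω ∂ℙ :=
          integral_mono_of_nonneg (Eventually.of_forall fun ω => sq_nonneg _) hdomint
            (Eventually.of_forall hpt)
      _ = D * p ^ N := by rw [hblocks, hDn]
      _ ≤ B * (θ ^ 2) ^ N := by gcongr
      _ = (θ ^ N) ^ 2 * B := by ring
  obtain ⟨ρ, hρ, C, hC, h⟩ := exists_geometric_bound hθ (by omega) hcov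
  exact ⟨ρ, hρ, C, hC, fun k _ => h k⟩
end

section
/- Assume the non-degeneracy condition holds, let {y_n} be the unique strictly stationary solution of the TMA(q) model, and for n ≥ (m+2)d + q define the truncation x_n = a_n + (b_n − a_n)·I_1, where I_1 = Σ_{j=1}^{⌊(n−q)/d⌋−1} (∏_{s=1}^{j−1} W_{n−sd}) U_{n−jd}. Then, if E|e_1| < ∞, there exist constants ρ ∈ (0,1) and C > 0 such that E|y_n − x_n| ≤ C·ρ^n for all sufficiently large n; moreover x_n is measurable with respect to σ(e_d, …, e_n) and hence independent of y_0. -/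
open MeasureTheory ProbabilityTheory Filter Finset

/-- The σ-algebra generated by the variables `e i`, `i ∈ S`. -/
abbrev sigmaOn {Ω : Type*} (e : ℤ → Ω → ℝ) (S : Set ℤ) : MeasurableSpace Ω :=
  ⨆ i ∈ S, MeasurableSpace.comap (e i) inferInstance

section SigmaOn

variable {Ω : Type*} {e : ℤ → Ω → ℝ} {S T : Set ℤ}

lemma sigmaOn_mono (h : S ⊆ T) : sigmaOn e S ≤ sigmaOn e T :=
  biSup_mono h

lemma measurable_sigmaOn {i : ℤ} (hi : i ∈ S) : Measurable[sigmaOn e S] (e i) :=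
  measurable_iff_comap_le.2
    (le_iSup₂_of_le (f := fun i (_ : i ∈ S) => MeasurableSpace.comap (e i) inferInstance)
      i hi le_rfl)

lemma sigmaOn_le [mΩ : MeasurableSpace Ω] (he : ∀ n, Measurable (e n)) : sigmaOn e S ≤ mΩ :=
  iSup₂_le fun i _ => measurable_iff_comap_le.1 (he i)

lemma indepFun_of_measurable_sigmaOn [MeasurableSpace Ω] {μ : Measure Ω}
    (he : ∀ n, Measurable (e n)) (hindep : iIndepFun e μ) (hST : Disjoint S T) {f g : Ω → ℝ}
    (hf : Measurable[sigmaOn e S] f) (hg : Measurable[sigmaOn e T] g) : IndepFun f g μ := by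
  have h := indep_iSup_of_disjoint (fun i => measurable_iff_comap_le.1 (he i)) hindep hST
  exact (IndepFun_iff_Indep _ _ _).2 (indep_of_indep_of_le_left
    (indep_of_indep_of_le_right h (measurable_iff_comap_le.1 hg)) (measurable_iff_comap_le.1 hf))

/-- Functions of disjoint blocks of an independent family have factorizing expectations. -/
lemma integral_mul_prod_blocks_s14 [MeasurableSpace Ω] {μ : Measure Ω}
    (he : ∀ n, Measurable (e n)) (hindep : iIndepFun e μ) {q D : ℕ} (hD : q < D) (n : ℤ)
    {c : Ω → ℝ} {V : ℤ → Ω → ℝ} (hc : Measurable[sigmaOn e (Set.Icc (n - q) n)] c)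
    (hV : ∀ k : ℤ, Measurable[sigmaOn e (Set.Icc (k - q) k)] (V k))
    (hci : Integrable c μ) (hVi : ∀ k, Integrable (V k) μ) {p : ℝ}
    (hp : ∀ k, ∫ ω, V k ω ∂μ = p) (L : ℕ) :
    Measurable[sigmaOn e (Set.Icc (n - L * D - q) n)]
        (c * ∏ k ∈ range L, V (n - ((k : ℤ) + 1) * D)) ∧
      Integrable (c * ∏ k ∈ range L, V (n - ((k : ℤ) + 1) * D)) μ ∧
      ∫ ω, (c * ∏ k ∈ range L, V (n - ((k : ℤ) + 1) * D)) ω ∂μ = (∫ ω, c ω ∂μ) * p ^ L := by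
  induction L with
  | zero =>
    simp only [range_zero, prod_empty, mul_one, pow_zero]
    exact ⟨hc.mono (sigmaOn_mono (by simp)) le_rfl, hci, trivial⟩
  | succ L ih =>
    obtain ⟨h1, h2, h3⟩ := ih
    have hLD : (0 : ℤ) ≤ L * D := by positivity
    have hind := indepFun_of_measurable_sigmaOn he hindep (by
      rw [Set.disjoint_left]
      rintro i ⟨hi, -⟩ ⟨-, hi'⟩
      have : ((L : ℤ) + 1) * D = L * D + D := by ring
      omega) h1 (hV (n - ((L : ℤ) + 1) * D))
    rw [prod_range_succ, ← mul_assoc]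
    refine ⟨?_, hind.integrable_mul h2 (hVi _), ?_⟩
    · have hs : ((L : ℤ) + 1) * D = L * D + D := by ring
      refine Measurable.mul (h1.mono (sigmaOn_mono ?_) le_rfl)
        ((hV _).mono (sigmaOn_mono ?_) le_rfl)
      · apply Set.Icc_subset_Icc <;> push_cast <;> omega
      · apply Set.Icc_subset_Icc <;> push_cast <;> omega
    · rw [hind.integral_mul_eq_mul_integral h2.1 (hVi _).1, h3, hp, pow_succ, mul_assoc]

end SigmaOn

section Series

lemma sum_prod_mul_eq_zero_or_one (J : ℕ) {u w : ℕ → ℝ} (hu : ∀ k, u k = 0 ∨ u k = 1)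
    (huw : ∀ k, u k + w k = 0 ∨ u k + w k = 1) :
    ∑ j ∈ range J, (∏ s ∈ range j, w s) * u j = 0 ∨
      ∑ j ∈ range J, (∏ s ∈ range j, w s) * u j = 1 := by
  induction J generalizing u w with
  | zero => simp
  | succ J ih =>
    have h : ∑ j ∈ range (J + 1), (∏ s ∈ range j, w s) * u j =
        u 0 + w 0 * ∑ j ∈ range J, (∏ s ∈ range j, w (s + 1)) * u (j + 1) := by
      rw [sum_range_succ', mul_sum, add_comm]
      simp [prod_range_succ', mul_comm, mul_left_comm]
    rw [h]
    rcases ih (u := fun k => u (k + 1)) (w := fun k => w (k + 1)) (fun k => hu _)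
      (fun k => huw _) with h | h
    · simpa [h] using hu 0
    · simpa [h] using huw 0

lemma tsum_prod_mul_mem_Icc {u w : ℕ → ℝ} (hu : ∀ k, u k = 0 ∨ u k = 1)
    (huw : ∀ k, u k + w k = 0 ∨ u k + w k = 1) :
    ∑' j, (∏ s ∈ range j, w s) * u j ∈ Set.Icc (0 : ℝ) 1 := by
  by_cases h : Summable fun j => (∏ s ∈ range j, w s) * u j
  · refine isClosed_Icc.mem_of_tendsto h.hasSum.tendsto_sum_nat (Eventually.of_forall fun J => ?_)
    rcases sum_prod_mul_eq_zero_or_one J hu huw with h | h <;> simp [h]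
  · simp [tsum_eq_zero_of_not_summable h]

/-- Truncating the series is exact as soon as one of the omitted factors vanishes. -/
lemma abs_tsum_sub_sum_le (J : ℕ) {u w : ℕ → ℝ} (hu : ∀ k, u k = 0 ∨ u k = 1)
    (huw : ∀ k, u k + w k = 0 ∨ u k + w k = 1) {s : Finset ℕ} (hs : s ⊆ range J) :
    |∑' j, (∏ s ∈ range j, w s) * u j - ∑ j ∈ range J, (∏ s ∈ range j, w s) * u j| ≤
      ∏ k ∈ s, if w k ≠ 0 then 1 else 0 := by
  by_cases h : ∃ k ∈ s, w k = 0
  · obtain ⟨k, hk, hwk⟩ := h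
    rw [tsum_eq_sum (s := range J), sub_self, abs_zero]
    · exact prod_nonneg fun _ _ => by split_ifs <;> norm_num
    · intro j hj
      have hkJ := mem_range.1 (hs hk)
      rw [prod_eq_zero (i := k) (mem_range.2 (hkJ.trans_le (by simpa using hj))) hwk, zero_mul]
  · push Not at h
    rw [prod_congr rfl fun k hk => if_pos (h k hk), prod_const_one]
    have h1 := tsum_prod_mul_mem_Icc hu huw
    rw [abs_le]
    rcases sum_prod_mul_eq_zero_or_one J hu huw with h | h <;> rw [h] <;>
      constructor <;> linarith [h1.1, h1.2]

end Series

section Model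

variable {Ω : Type*} [MeasurableSpace Ω] {e : ℤ → Ω → ℝ} {q : ℕ} {n : ℤ}

lemma measurable_movingAverage (h : ∀ i ∈ Set.Icc (n - q) n, Measurable (e i)) (c : ℝ)
    (θ : ℕ → ℝ) :
    Measurable fun ω => c + e n ω + ∑ i ∈ Finset.Icc 1 q, θ i * e (n - i) ω := by
  refine ((h n ⟨by omega, le_rfl⟩).const_add c).add (Finset.measurable_fun_sum _ fun i hi => ?_)
  rw [Finset.mem_Icc] at hi
  exact (h _ ⟨by omega, by omega⟩).const_mul _

lemma measurable_ite_le {α : Type*} {_ : MeasurableSpace α} {f : α → ℝ} (hf : Measurable f) (r : ℝ) :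
    Measurable fun z => if f z ≤ r then (1 : ℝ) else 0 :=
  Measurable.ite (measurableSet_le hf measurable_const) measurable_const measurable_const

lemma measurable_tsum_real {α : Type*} {_ : MeasurableSpace α} {f : ℕ → α → ℝ}
    (hf : ∀ j, Measurable (f j)) : Measurable fun z => ∑' j, f j z :=
  Measurable.tsum hf

lemma integrable_movingAverage {μ : Measure Ω} [IsFiniteMeasure μ]
    (h : ∀ i, Integrable (e i) μ) (c : ℝ) (θ : ℕ → ℝ) :
    Integrable (fun ω => c + e n ω + ∑ i ∈ Finset.Icc 1 q, θ i * e (n - i) ω) μ :=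
  ((integrable_const c).add (h n)).add
    (integrable_finsetSum _ fun _ _ => (h _).const_mul _)

/-- The lagged sequences of an i.i.d. family all have the same law. -/
lemma identDistrib_lags {μ : Measure Ω} [IsProbabilityMeasure μ]
    (he : ∀ n, Measurable (e n)) (hindep : iIndepFun e μ)
    (hident : ∀ n, Measure.map (e n) μ = Measure.map (e 0) μ) (n k : ℤ) :
    IdentDistrib (fun ω (i : ℕ) => e (n - i) ω) (fun ω (i : ℕ) => e (k - i) ω) μ μ := by
  have hlaw : ∀ l : ℤ, μ.map (fun ω (i : ℕ) => e (l - i) ω) =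
      Measure.infinitePi fun _ : ℕ => μ.map (e 0) := fun l => by
    have hinj : Function.Injective fun i : ℕ => l - (i : ℤ) := fun i j h => by
      simpa using h
    have := (hindep.precomp hinj).map_fun_eq_infinitePi_map (fun i => he _)
    simpa [Function.comp_def, hident (l - _)] using this
  exact ⟨(measurable_pi_lambda _ fun _ => he _).aemeasurable,
    (measurable_pi_lambda _ fun _ => he _).aemeasurable, by rw [hlaw, hlaw]⟩

end Model

lemma sum_Icc_prod_Icc_eq_range (u w : ℕ → ℝ) (J : ℕ) :
    ∑ j ∈ Finset.Icc 1 J, (∏ s ∈ Finset.Icc 1 (j - 1), w s) * u j =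
      ∑ j ∈ range J, (∏ s ∈ range j, w (s + 1)) * u (j + 1) := by
  have hI : ∀ k, Finset.Icc 1 k = Finset.Ico 1 (k + 1) := fun k => rfl
  simp only [hI, sum_Ico_eq_sum_range, prod_Ico_eq_prod_range]
  simp [add_comm]

/-- Geometric decay along blocks of length `D` is geometric decay in `n`. -/
lemma exists_geometric_bound_s14 {p : ℝ} (hp0 : 0 ≤ p) (hp1 : p < 1) {D : ℕ} (hD : 0 < D) (A : ℕ) :
    ∃ ρ ∈ Set.Ioo (0 : ℝ) 1, ∃ C > (0 : ℝ), ∀ n L : ℕ, n ≤ A + D * L → p ^ L ≤ C * ρ ^ n := by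
  obtain ⟨p', hpp', hp1'⟩ := exists_between hp1
  have hp0' : 0 < p' := hp0.trans_lt hpp'
  obtain ⟨ρ, hρ, hρD⟩ : ∃ ρ : ℝ, 0 < ρ ∧ ρ ^ D = p' :=
    ⟨p' ^ ((D : ℝ)⁻¹), by positivity, Real.rpow_inv_natCast_pow hp0'.le hD.ne'⟩
  have hρ1 : ρ < 1 := by
    by_contra! h
    exact absurd (one_le_pow₀ (n := D) h) (by rw [hρD]; exact not_le.2 hp1')
  refine ⟨ρ, ⟨hρ, hρ1⟩, (ρ ^ A)⁻¹, by positivity, fun n L h => ?_⟩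
  calc p ^ L ≤ p' ^ L := pow_le_pow_left₀ hp0 hpp'.le L
    _ = (ρ ^ A)⁻¹ * ρ ^ (A + D * L) := by
      rw [pow_add, pow_mul, hρD, inv_mul_cancel_left₀ (by positivity)]
    _ ≤ (ρ ^ A)⁻¹ * ρ ^ n := by gcongr ?_ * ?_; exact pow_le_pow_of_le_one hρ.le hρ1.le h

/-- With `{y_n}` the unique strictly stationary solution and, for
`n ≥ (m+2)d + q`, the truncation `x_n = a_n + (b_n − a_n)·I₁` where
`I₁ = Σ_{j=1}^{⌊(n−q)/d⌋−1} (∏_{s=1}^{j−1} W_{n−sd}) U_{n−jd}`: if `E|e₁| < ∞`,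
there exist `ρ ∈ (0,1)` and `C > 0` such that `E|y_n − x_n| ≤ C·ρ^n` for all
sufficiently large `n`; moreover `x_n` is measurable with respect to
`σ(e_d, …, e_n)` and hence independent of `y_0`. -/
theorem tma_truncation_approximation
    {Ω : Type*} [MeasureSpace Ω] [IsProbabilityMeasure (ℙ : Measure Ω)]
    (e : ℤ → Ω → ℝ)
    (he : ∀ n, Measurable (e n))
    (hindep : iIndepFun e ℙ)
    (hident : ∀ n, Measure.map (e n) ℙ = Measure.map (e 0) ℙ)
    (q d : ℕ) (hq : 0 < q) (hd : 0 < d)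
    (r μ1 μ2 : ℝ) (φ ψ : ℕ → ℝ)
    (a b U W : ℤ → Ω → ℝ)
    (ha : ∀ n ω, a n ω = μ2 + e n ω + ∑ i ∈ Finset.Icc 1 q, ψ i * e (n - i) ω)
    (hb : ∀ n ω, b n ω = μ1 + e n ω + ∑ i ∈ Finset.Icc 1 q, φ i * e (n - i) ω)
    (hU : ∀ n ω, U n ω = if a n ω ≤ r then 1 else 0)
    (hW : ∀ n ω, W n ω = (if b n ω ≤ r then 1 else 0) - (if a n ω ≤ r then 1 else 0))
    (hnd : ℙ {ω | a 1 ω ≤ r ∧ b 1 ω ≤ r} + ℙ {ω | r < a 1 ω ∧ r < b 1 ω} ≠ 0)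
    (hmom : Integrable (e 1) ℙ)
    (m : ℕ) (hm1 : m * d < max d (q + 1)) (hm2 : max d (q + 1) ≤ (m + 1) * d)
    (α : ℤ → Ω → ℝ)
    (hα : ∀ n ω, α n ω =
      ∑' j : ℕ, (∏ s ∈ Finset.range j, W (n - (s : ℤ) * d) ω) * U (n - (j : ℤ) * d) ω)
    (y : ℤ → Ω → ℝ)
    (hy : ∀ n ω, y n ω = a n ω + (b n ω - a n ω) * α (n - d) ω)
    (x : ℤ → Ω → ℝ)
    (hx : ∀ n ω, x n ω = a n ω + (b n ω - a n ω)
      * ∑ j ∈ Finset.Icc 1 (((n - q) / (d : ℤ)).toNat - 1),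
          (∏ s ∈ Finset.Icc 1 (j - 1), W (n - (s : ℤ) * d) ω)
            * U (n - (j : ℤ) * d) ω) :
    (∃ ρ ∈ Set.Ioo (0 : ℝ) 1, ∃ C > (0 : ℝ), ∃ N : ℤ,
      ∀ n : ℤ, ((m : ℤ) + 2) * d + q ≤ n → N ≤ n →
        ∫ ω, |y n ω - x n ω| ∂ℙ ≤ C * ρ ^ n.toNat) ∧
    (∀ n : ℤ, ((m : ℤ) + 2) * d + q ≤ n →
      Measurable[⨆ i ∈ Set.Icc (d : ℤ) n, MeasurableSpace.comap (e i) inferInstance]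
          (x n) ∧
        IndepFun (x n) (y 0) ℙ) := by
  have hD : q < (m + 1) * d := by omega
  have hd' : (0 : ℤ) < d := by exact_mod_cast hd
  have hmeas : ∀ (k : ℤ) (S : Set ℤ), Set.Icc (k - q) k ⊆ S →
      Measurable[sigmaOn e S] (a k) ∧ Measurable[sigmaOn e S] (b k) ∧
      Measurable[sigmaOn e S] (U k) ∧ Measurable[sigmaOn e S] (W k) := by
    intro k S hS
    have h : ∀ i ∈ Set.Icc (k - q) k, Measurable[sigmaOn e S] (e i) :=
      fun i hi => measurable_sigmaOn (hS hi)
    have hma : Measurable[sigmaOn e S] (a k) := by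
      rw [funext (ha k)]
      exact @measurable_movingAverage Ω (sigmaOn e S) e q k h μ2 ψ
    have hmb : Measurable[sigmaOn e S] (b k) := by
      rw [funext (hb k)]
      exact @measurable_movingAverage Ω (sigmaOn e S) e q k h μ1 φ
    refine ⟨hma, hmb, ?_, ?_⟩
    · rw [funext (hU k)]; exact measurable_ite_le hma r
    · rw [funext (hW k)]; exact (measurable_ite_le hmb r).sub (measurable_ite_le hma r)
  have hx' : ∀ n ω, x n ω = a n ω + (b n ω - a n ω) *
      ∑ j ∈ range (((n - q) / (d : ℤ)).toNat - 1),
        (∏ s ∈ range j, W (n - d - (s : ℤ) * d) ω) * U (n - d - (j : ℤ) * d) ω := by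
    intro n ω
    rw [hx, sum_Icc_prod_Icc_eq_range (fun j => U (n - (j : ℤ) * d) ω)
      (fun s => W (n - (s : ℤ) * d) ω)]
    have hshift : ∀ s : ℕ, n - ((s + 1 : ℕ) : ℤ) * d = n - d - (s : ℤ) * d := fun s => by
      push_cast; ring
    simp only [hshift]
  refine ⟨?_, fun n hn => ?_⟩
  · set V : ℤ → Ω → ℝ := fun k ω => if W k ω ≠ 0 then 1 else 0 with hVdef
    have hVm : ∀ k : ℤ, Measurable[sigmaOn e (Set.Icc (k - q) k)] (V k) := fun k =>
      Measurable.ite ((hmeas k _ subset_rfl).2.2.2 (measurableSet_singleton 0).compl)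
        measurable_const measurable_const
    have hVm' : ∀ k, Measurable (V k) := fun k => (hVm k).mono (sigmaOn_le he) le_rfl
    have hVi : ∀ k, Integrable (V k) ℙ := fun k =>
      Integrable.of_bound (hVm' k).aestronglyMeasurable 1
        (Eventually.of_forall fun ω => by simp only [hVdef]; split_ifs <;> simp)
    have hei : ∀ k, Integrable (e k) ℙ := fun k => by
      have : IdentDistrib (e k) (e 1) ℙ ℙ :=
        ⟨(he k).aemeasurable, (he 1).aemeasurable, by rw [hident k, hident 1]⟩
      exact this.integrable_iff.2 hmom
    have hci : ∀ k, Integrable (fun ω => |b k ω - a k ω|) ℙ := fun k => by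
      simp only [ha, hb]
      exact ((integrable_movingAverage hei μ1 φ).sub (integrable_movingAverage hei μ2 ψ)).abs
    have hlag := identDistrib_lags he hindep hident
    let A : (ℕ → ℝ) → ℝ := fun z => μ2 + z 0 + ∑ i ∈ Finset.Icc 1 q, ψ i * z i
    let B : (ℕ → ℝ) → ℝ := fun z => μ1 + z 0 + ∑ i ∈ Finset.Icc 1 q, φ i * z i
    have hA : Measurable A := by fun_prop
    have hB : Measurable B := by fun_prop
    have haA : ∀ k ω, a k ω = A fun i : ℕ => e (k - i) ω := fun k ω => by simp [ha, A]
    have hbB : ∀ k ω, b k ω = B fun i : ℕ => e (k - i) ω := fun k ω => by simp [hb, B]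
    have hc_int : ∀ k, ∫ ω, |b k ω - a k ω| ∂ℙ = ∫ ω, |b 1 ω - a 1 ω| ∂ℙ := fun k => by
      simp only [haA, hbB]
      exact ((hlag k 1).comp (u := fun z => |B z - A z|) (hB.sub hA).abs).integral_eq
    have hV_int : ∀ k, ∫ ω, V k ω ∂ℙ = ∫ ω, V 1 ω ∂ℙ := fun k => by
      simp only [hVdef, hW, haA, hbB]
      refine ((hlag k 1).comp (u := fun z => if ((if B z ≤ r then (1 : ℝ) else 0) -
        (if A z ≤ r then 1 else 0)) ≠ 0 then (1 : ℝ) else 0) ?_).integral_eq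
      exact Measurable.ite (((measurable_ite_le hB r).sub (measurable_ite_le hA r))
        (measurableSet_singleton 0).compl) measurable_const measurable_const
    have hp0 : 0 ≤ ∫ ω, V 1 ω ∂ℙ := integral_nonneg fun ω => by
      simp only [hVdef, Pi.zero_apply]; split_ifs <;> norm_num
    have hp1 : ∫ ω, V 1 ω ∂ℙ < 1 := by
      by_contra! h
      have hle : ∀ ω, 0 ≤ 1 - V 1 ω := fun ω => by
        simp only [hVdef]; split_ifs <;> norm_num
      have hint : ∫ ω, (1 - V 1 ω) ∂ℙ = 0 := by
        refine le_antisymm ?_ (integral_nonneg hle)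
        rw [integral_sub (integrable_const _) (hVi 1)]
        simpa using h
      have hae := (integral_eq_zero_iff_of_nonneg hle ((integrable_const _).sub (hVi 1))).1 hint
      have hnull : ∀ᵐ ω ∂ℙ, W 1 ω ≠ 0 := by
        filter_upwards [hae] with ω hω hW0
        simp [hVdef, hW0] at hω
      refine hnd ?_
      rw [measure_mono_null (fun ω hω => ?_) (ae_iff.1 hnull),
        measure_mono_null (fun ω hω => ?_) (ae_iff.1 hnull), add_zero]
      · simp [hW, not_le.2 hω.1, not_le.2 hω.2]
      · simp [hW, hω.1, hω.2]
    obtain ⟨ρ, hρ, C, hC, hbound⟩ := exists_geometric_bound_s14 hp0 hp1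
      (D := (m + 1) * d) (by positivity) (q + d + (m + 1) * d)
    have hc0 : 0 ≤ ∫ ω, |b 1 ω - a 1 ω| ∂ℙ := integral_nonneg fun ω => abs_nonneg _
    refine ⟨ρ, hρ, (∫ ω, |b 1 ω - a 1 ω| ∂ℙ + 1) * C, by positivity, 0, fun n hn hn0 => ?_⟩
    set J := ((n - q) / (d : ℤ)).toNat - 1 with hJ
    set L := J / (m + 1) with hL
    have hcm : Measurable[sigmaOn e (Set.Icc (n - q) n)] fun ω => |b n ω - a n ω| := by
      obtain ⟨h1, h2, -⟩ := hmeas n _ subset_rfl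
      exact continuous_abs.measurable.comp (h2.sub h1)
    obtain ⟨-, hFi, hFint⟩ := integral_mul_prod_blocks_s14 he hindep hD n hcm hVm (hci n) hVi hV_int L
    have hpt : ∀ ω, |y n ω - x n ω| ≤
        ((fun ω => |b n ω - a n ω|) *
          ∏ k ∈ range L, V (n - ((k : ℤ) + 1) * ((m + 1) * d : ℕ))) ω := by
      intro ω
      have hu : ∀ k : ℕ, U (n - d - (k : ℤ) * d) ω = 0 ∨ U (n - d - (k : ℤ) * d) ω = 1 :=
        fun k => by rw [hU]; split_ifs <;> simp
      have huw : ∀ k : ℕ, U (n - d - (k : ℤ) * d) ω + W (n - d - (k : ℤ) * d) ω = 0 ∨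
          U (n - d - (k : ℤ) * d) ω + W (n - d - (k : ℤ) * d) ω = 1 :=
        fun k => by rw [hU, hW]; split_ifs <;> simp
      have hinj : Set.InjOn (fun k => (k + 1) * (m + 1) - 1) (range L : Set ℕ) := by
        intro i _ j _ hij
        have hi : 0 < (i + 1) * (m + 1) := by positivity
        have hj : 0 < (j + 1) * (m + 1) := by positivity
        have : (i + 1) * (m + 1) = (j + 1) * (m + 1) := by
          simp only at hij; omega
        simpa using Nat.eq_of_mul_eq_mul_right (Nat.succ_pos m) this
      have hsub : (range L).image (fun k => (k + 1) * (m + 1) - 1) ⊆ range J := by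
        intro s hs
        obtain ⟨k, hk, rfl⟩ := mem_image.1 hs
        have h1 : (k + 1) * (m + 1) ≤ L * (m + 1) :=
          Nat.mul_le_mul_right _ (mem_range.1 hk)
        have h2 : L * (m + 1) ≤ J := Nat.div_mul_le_self _ _
        have hi : 0 < (k + 1) * (m + 1) := by positivity
        rw [mem_range]; omega
      have h := abs_tsum_sub_sum_le J hu huw hsub
      rw [prod_image hinj] at h
      have hdiff : y n ω - x n ω = (b n ω - a n ω) *
          (α (n - d) ω - ∑ j ∈ range J,
            (∏ s ∈ range j, W (n - d - (s : ℤ) * d) ω) * U (n - d - (j : ℤ) * d) ω) := by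
        rw [hy, hx']; ring
      rw [hdiff, abs_mul, hα, Pi.mul_apply, prod_apply]
      refine mul_le_mul_of_nonneg_left (h.trans_eq (prod_congr rfl fun k _ => ?_)) (abs_nonneg _)
      have hidx : n - d - (((k + 1) * (m + 1) - 1 : ℕ) : ℤ) * d =
          n - ((k : ℤ) + 1) * ((m + 1) * d : ℕ) := by
        rw [Nat.cast_sub (Nat.succ_le_of_lt (by positivity))]
        push_cast; ring
      simp only [hVdef, hidx]
    have hnL : n.toNat ≤ q + d + (m + 1) * d + (m + 1) * d * L := by
      have h1 : J < (m + 1) * (L + 1) := Nat.lt_mul_div_succ J (Nat.succ_pos m)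
      have h2 : n - q < d * ((n - q) / (d : ℤ) + 1) := by
        linarith [Int.lt_ediv_add_one_mul_self (n - q) hd']
      have h3 : (n - q) / (d : ℤ) ≤ (m + 1) * (L + 1) := by
        have : (J : ℤ) < (m + 1) * (L + 1) := by exact_mod_cast h1
        omega
      have h4 : (d : ℤ) * ((n - q) / (d : ℤ) + 1) ≤ d * ((m + 1) * (L + 1) + 1) := by gcongr
      have h5 : n ≤ ((q + d + (m + 1) * d + (m + 1) * d * L : ℕ) : ℤ) := by
        push_cast; linarith
      omega
    calc ∫ ω, |y n ω - x n ω| ∂ℙ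
        ≤ (∫ ω, |b 1 ω - a 1 ω| ∂ℙ) * (∫ ω, V 1 ω ∂ℙ) ^ L := by
          rw [← hc_int n, ← hFint]
          exact integral_mono_of_nonneg (Eventually.of_forall fun ω => abs_nonneg _) hFi
            (Eventually.of_forall hpt)
      _ ≤ (∫ ω, |b 1 ω - a 1 ω| ∂ℙ + 1) * (C * ρ ^ n.toNat) := by
          gcongr
          · linarith
          · exact hbound _ _ hnL
      _ = _ := by ring
  · have hmd : (0 : ℤ) ≤ m * d := by positivity
    have hn' : (m : ℤ) * d + 2 * d + q ≤ n := by linarith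
    have hxm : Measurable[sigmaOn e (Set.Icc (d : ℤ) n)] (x n) := by
      obtain ⟨hma, hmb, -⟩ := hmeas n (Set.Icc (d : ℤ) n)
        (Set.Icc_subset_Icc (by omega) le_rfl)
      have hlagm : ∀ j < ((n - q) / (d : ℤ)).toNat - 1,
          Set.Icc (n - d - (j : ℤ) * d - q) (n - d - (j : ℤ) * d) ⊆ Set.Icc (d : ℤ) n := by
        intro j hj
        have h1 : (j : ℤ) + 2 ≤ (n - q) / (d : ℤ) := by omega
        have h2 : ((j : ℤ) + 2) * d ≤ n - q :=
          (mul_le_mul_of_nonneg_right h1 hd'.le).trans (Int.ediv_mul_le _ hd'.ne')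
        have h3 : (0 : ℤ) ≤ j * d := by positivity
        exact Set.Icc_subset_Icc (by linarith) (by linarith)
      rw [funext (hx' n)]
      refine hma.add ((hmb.sub hma).mul (Finset.measurable_fun_sum _ fun j hj => ?_))
      have hj := mem_range.1 hj
      exact (Finset.measurable_fun_prod _ fun s hs =>
        (hmeas _ _ (hlagm s ((mem_range.1 hs).trans hj))).2.2.2).mul
          (hmeas _ _ (hlagm j hj)).2.2.1
    have hym : Measurable[sigmaOn e (Set.Iic 0)] (y 0) := by
      have hlagm : ∀ j : ℕ, Set.Icc (0 - d - (j : ℤ) * d - q) (0 - d - (j : ℤ) * d) ⊆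
          Set.Iic (0 : ℤ) := by
        rintro j i ⟨-, hi⟩
        have h3 : (0 : ℤ) ≤ j * d := by positivity
        exact Set.mem_Iic.2 (by linarith)
      obtain ⟨hma, hmb, -⟩ := hmeas 0 (Set.Iic 0) Set.Icc_subset_Iic_self
      rw [funext (hy 0)]
      simp only [hα]
      exact hma.add ((hmb.sub hma).mul (measurable_tsum_real fun j =>
        (Finset.measurable_fun_prod _ fun s _ => (hmeas _ _ (hlagm s)).2.2.2).mul
          (hmeas _ _ (hlagm j)).2.2.1))
    refine ⟨hxm, indepFun_of_measurable_sigmaOn he hindep ?_ hxm hym⟩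
    rw [Set.disjoint_left]
    rintro i ⟨hi, -⟩ hi'
    have := Set.mem_Iic.1 hi'
    omega
end
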